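/- Let Ω ⊆ ℝ² be a nonempty bounded open set, let 2 < p < ∞, let 0 < λ < λ_p, and set ψ(u) = λ (∫_Ω |u(x)|^p dx)^{2/p}. Then the supremum of ∫_Ω e^{4π u(x)²/(1−ψ(u))} dx over all u ∈ C_c^∞(Ω) with ∫_Ω |∇u(x)|² dx ≤ 1 and ψ(u) < 1 is finite, and for every such u one has ∫_Ω e^{4π (1+ψ(u)) u(x)²} dx ≤ ∫_Ω e^{4π u(x)²/(1−ψ(u))} dx. -/

import Mathlib

open MeasureTheory Real Set Filter
open scoped ENNReal

noncomputable section

abbrev E2 := EuclideanSpace ℝ (Fin 2)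

/-- `u ∈ C_c^∞(Ω)`: smooth with compact support contained in `Ω`. -/
def IsTestFun (Ω : Set E2) (u : E2 → ℝ) : Prop :=
  ContDiff ℝ (⊤ : ℕ∞) u ∧ IsCompact (tsupport u) ∧ tsupport u ⊆ Ω

/-- `Ω*`: the open disk centered at the origin with the same area as `Ω`. -/
def symDisk (Ω : Set E2) : Set E2 := Metric.ball 0 (Real.sqrt ((volume Ω).toReal / π))

/-- `λ_p`: the infimum of `∫_{Ω*} |∇u|²` over `u ∈ C_c^∞(Ω*)` with `‖u‖_{L^p(Ω*)} = 1`. -/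
def lambdaP (Ω : Set E2) (p : ℝ) : ℝ :=
  sInf {c : ℝ | ∃ u : E2 → ℝ, IsTestFun (symDisk Ω) u ∧
    (∫ x in symDisk Ω, |u x| ^ p) ^ (1 / p) = 1 ∧
    c = ∫ x in symDisk Ω, ‖fderiv ℝ u x‖ ^ 2}

section helpers

open scoped Pointwise Topology

/-! ### The Brunn–Minkowski inequality in the plane -/

theorem IsCompact.volume_add_volume_le_volume_add {K L : Set ℝ} (hK : IsCompact K)
    (hL : IsCompact L) (nK : K.Nonempty) (nL : L.Nonempty) :
    volume K + volume L ≤ volume (K + L) := by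
  obtain ⟨a, haK, ha⟩ := hK.exists_isGreatest nK
  obtain ⟨b, hbL, hb⟩ := hL.exists_isLeast nL
  have h1 : volume ((fun x => x + b) '' K) = volume K := by
    rw [Set.image_add_right, measure_preimage_add_right]
  have h2 : volume ((fun x => a + x) '' L) = volume L := by
    rw [Set.image_add_left, measure_preimage_add]
  have hdisj : AEDisjoint volume ((fun x => x + b) '' K) ((fun x => a + x) '' L) := by
    refine measure_mono_null (t := {a + b}) ?_ (by simp)
    rintro _ ⟨⟨x, hx, rfl⟩, ⟨y, hy, hxy⟩⟩
    have h3 := ha hx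
    have h4 := hb hy
    simp only [Set.mem_singleton_iff]
    simp only at hxy
    linarith
  have hm : NullMeasurableSet ((fun x => a + x) '' L) :=
    ((hL.image (by fun_prop)).measurableSet).nullMeasurableSet
  rw [← h1, ← h2, ← measure_union₀ hm hdisj]
  apply measure_mono
  rintro _ (⟨x, hx, rfl⟩ | ⟨y, hy, rfl⟩)
  · exact Set.add_mem_add hx hbL
  · exact Set.add_mem_add haK hy

theorem MeasurableSet.volume_add_volume_le_volume_add {A B : Set ℝ} (hA : MeasurableSet A)
    (hB : MeasurableSet B) (nA : A.Nonempty) (nB : B.Nonempty) :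
    volume A + volume B ≤ volume (A + B) := by
  obtain ⟨a, ha⟩ := nA
  obtain ⟨b, hb⟩ := nB
  rw [hA.measure_eq_iSup_isCompact, hB.measure_eq_iSup_isCompact]
  simp only [iSup_and']
  refine ENNReal.biSup_add_biSup_le' ⟨∅, by simp⟩ ⟨∅, by simp⟩ ?_
  rintro K ⟨hKA, hK⟩ L ⟨hLB, hL⟩
  calc volume K + volume L ≤ volume (insert a K) + volume (insert b L) :=
        add_le_add (measure_mono (subset_insert _ _)) (measure_mono (subset_insert _ _))
    _ ≤ volume (insert a K + insert b L) :=
        (hK.insert a).volume_add_volume_le_volume_add (hL.insert b) (insert_nonempty _ _)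
          (insert_nonempty _ _)
    _ ≤ _ := measure_mono (Set.add_subset_add (insert_subset ha hKA) (insert_subset hb hLB))

/-- The length of the vertical section of a planar set. -/
def sectionLength (A : Set (ℝ × ℝ)) (x : ℝ) : ℝ := (volume (Prod.mk x ⁻¹' A)).toReal

theorem sectionLength_nonneg (A : Set (ℝ × ℝ)) (x : ℝ) : 0 ≤ sectionLength A x :=
  ENNReal.toReal_nonneg

theorem measurable_sectionLength {A : Set (ℝ × ℝ)} (hA : MeasurableSet A) :
    Measurable (sectionLength A) :=
  (measurable_measure_prodMk_left hA).ennreal_toReal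

theorem volume_section_lt_top {A : Set (ℝ × ℝ)} (hb : Bornology.IsBounded A) (x : ℝ) :
    volume (Prod.mk x ⁻¹' A) < ∞ := by
  have : Bornology.IsBounded (Prod.snd '' A) := hb.image_snd
  refine (measure_mono (t := Prod.snd '' A) ?_).trans_lt this.measure_lt_top
  intro y hy
  exact ⟨(x, y), hy, rfl⟩

theorem bddAbove_sectionLength {A : Set (ℝ × ℝ)} (hb : Bornology.IsBounded A) :
    BddAbove (range (sectionLength A)) := by
  have : Bornology.IsBounded (Prod.snd '' A) := hb.image_snd
  refine ⟨(volume (Prod.snd '' A)).toReal, ?_⟩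
  rintro _ ⟨x, rfl⟩
  refine ENNReal.toReal_mono this.measure_lt_top.ne (measure_mono ?_)
  intro y hy
  exact ⟨(x, y), hy, rfl⟩

theorem lintegral_sectionLength {A : Set (ℝ × ℝ)} (hA : MeasurableSet A)
    (hb : Bornology.IsBounded A) :
    ∫⁻ x, ENNReal.ofReal (sectionLength A x) = volume A := by
  rw [Measure.volume_eq_prod, Measure.prod_apply hA]
  refine lintegral_congr fun x => ?_
  rw [sectionLength, ENNReal.ofReal_toReal (volume_section_lt_top hb x).ne]

theorem iSup_sectionLength_pos {A : Set (ℝ × ℝ)} (hA : IsOpen A) (nA : A.Nonempty)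
    (hb : Bornology.IsBounded A) : 0 < ⨆ x, sectionLength A x := by
  obtain ⟨⟨x, y⟩, hxy⟩ := nA
  refine lt_of_lt_of_le ?_ (le_ciSup (bddAbove_sectionLength hb) x)
  refine ENNReal.toReal_pos ?_ (volume_section_lt_top hb x).ne
  exact ((hA.preimage (by fun_prop)).measure_pos _ ⟨y, hxy⟩).ne'

theorem lintegral_div_iSup_sectionLength {A : Set (ℝ × ℝ)} (hA : IsOpen A) (nA : A.Nonempty)
    (hb : Bornology.IsBounded A) :
    volume A / ENNReal.ofReal (⨆ x, sectionLength A x) =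
      ∫⁻ t in Ioo (0 : ℝ) 1, volume {x | t * (⨆ x, sectionLength A x) < sectionLength A x} := by
  set M := ⨆ x, sectionLength A x with hM
  have hMpos : 0 < M := iSup_sectionLength_pos hA nA hb
  have hmeas := measurable_sectionLength hA.measurableSet
  have h1 : ∫⁻ x, ENNReal.ofReal (sectionLength A x / M) = volume A / ENNReal.ofReal M := by
    simp_rw [ENNReal.ofReal_div_of_pos hMpos, div_eq_mul_inv]
    rw [lintegral_mul_const _ hmeas.ennreal_ofReal, lintegral_sectionLength hA.measurableSet hb]
  rw [← h1, lintegral_eq_lintegral_meas_lt _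
    (Eventually.of_forall fun x => div_nonneg (sectionLength_nonneg A x) hMpos.le)
    (hmeas.div_const M).aemeasurable]
  simp_rw [lt_div_iff₀ hMpos]
  have h2 : Ioo (0 : ℝ) 1 = Ioi 0 ∩ Iio 1 := rfl
  rw [← lintegral_indicator measurableSet_Ioi, ← lintegral_indicator measurableSet_Ioo]
  refine lintegral_congr fun t => ?_
  by_cases ht : t < 1
  · by_cases ht0 : 0 < t
    · rw [indicator_of_mem (by exact ht0), indicator_of_mem (by exact ⟨ht0, ht⟩)]
    · rw [indicator_of_notMem (by exact ht0), indicator_of_notMem (fun h => ht0 h.1)]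
  · rw [indicator_of_notMem (s := Ioo 0 1) (fun h => ht h.2)]
    have : {x | t * M < sectionLength A x} = ∅ := by
      ext x
      simp only [mem_ofPred_eq, mem_empty_iff_false, iff_false, not_lt]
      have := le_ciSup (bddAbove_sectionLength hb) x
      rw [← hM] at this
      nlinarith
    simp [indicator, this]

theorem bonnesen_inequality {A B : Set (ℝ × ℝ)} (hA : IsOpen A) (hB : IsOpen B)
    (nA : A.Nonempty) (nB : B.Nonempty) (bA : Bornology.IsBounded A)
    (bB : Bornology.IsBounded B) :
    volume A / ENNReal.ofReal (⨆ x, sectionLength A x) +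
      volume B / ENNReal.ofReal (⨆ x, sectionLength B x) ≤
    volume (A + B) /
      ENNReal.ofReal ((⨆ x, sectionLength A x) + ⨆ x, sectionLength B x) := by
  rw [lintegral_div_iSup_sectionLength hA nA bA, lintegral_div_iSup_sectionLength hB nB bB]
  have hM := iSup_sectionLength_pos hA nA bA
  have hN := iSup_sectionLength_pos hB nB bB
  set M := ⨆ x, sectionLength A x with hMdef
  set N := ⨆ x, sectionLength B x with hNdef
  have hAB : IsOpen (A + B) := hA.add_right
  have bAB : Bornology.IsBounded (A + B) := bA.add bB
  have hmA := measurable_sectionLength hA.measurableSet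
  have hmB := measurable_sectionLength hB.measurableSet
  have hmAB := measurable_sectionLength hAB.measurableSet
  have hMN : 0 < M + N := by positivity
  have h1 : ∫⁻ x, ENNReal.ofReal (sectionLength (A + B) x / (M + N)) =
      volume (A + B) / ENNReal.ofReal (M + N) := by
    simp_rw [ENNReal.ofReal_div_of_pos hMN, div_eq_mul_inv]
    rw [lintegral_mul_const _ hmAB.ennreal_ofReal, lintegral_sectionLength hAB.measurableSet bAB]
  rw [← h1, lintegral_eq_lintegral_meas_lt _
    (Eventually.of_forall fun x => div_nonneg (sectionLength_nonneg _ x) hMN.le)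
    (hmAB.div_const _).aemeasurable]
  have hanti : Antitone fun t : ℝ => volume {x | t * M < sectionLength A x} := by
    intro s t hst
    refine measure_mono fun x hx => ?_
    simp only [mem_ofPred_eq] at hx ⊢
    nlinarith
  rw [← lintegral_add_left hanti.measurable]
  refine le_trans ?_ (lintegral_mono_set (s := Ioo (0 : ℝ) 1) Ioo_subset_Ioi_self)
  refine setLIntegral_mono' measurableSet_Ioo fun t ht => ?_
  obtain ⟨x, hx⟩ : ∃ x, t * M < sectionLength A x :=
    exists_lt_of_lt_ciSup (by rw [← hMdef]; nlinarith [ht.2])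
  obtain ⟨y, hy⟩ : ∃ y, t * N < sectionLength B y :=
    exists_lt_of_lt_ciSup (by rw [← hNdef]; nlinarith [ht.2])
  refine (MeasurableSet.volume_add_volume_le_volume_add (measurableSet_lt measurable_const hmA)
    (measurableSet_lt measurable_const hmB) ⟨x, hx⟩ ⟨y, hy⟩).trans (measure_mono ?_)
  rintro _ ⟨x, hx, y, hy, rfl⟩
  simp only [mem_ofPred_eq] at hx hy ⊢
  rw [lt_div_iff₀ hMN]
  have hpos : ∀ {C : Set (ℝ × ℝ)} {R z : ℝ}, 0 < R → t * R < sectionLength C z →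
      (Prod.mk z ⁻¹' C).Nonempty := by
    intro C R z hR h
    rw [nonempty_iff_ne_empty]
    intro h0
    rw [sectionLength, h0, measure_empty, ENNReal.toReal_zero] at h
    nlinarith [mul_pos ht.1 hR]
  have hsec := MeasurableSet.volume_add_volume_le_volume_add
    ((hA.preimage (f := Prod.mk x) (by fun_prop)).measurableSet)
    ((hB.preimage (f := Prod.mk y) (by fun_prop)).measurableSet) (hpos hM hx) (hpos hN hy)
  have hsub : Prod.mk x ⁻¹' A + Prod.mk y ⁻¹' B ⊆ Prod.mk (x + y) ⁻¹' (A + B) := by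
    rintro _ ⟨a, ha, b, hb, rfl⟩
    exact ⟨(x, a), ha, (y, b), hb, rfl⟩
  have h3 := ENNReal.toReal_mono (volume_section_lt_top bAB (x + y)).ne
    (hsec.trans (measure_mono hsub))
  rw [ENNReal.toReal_add (volume_section_lt_top bA x).ne (volume_section_lt_top bB y).ne] at h3
  change sectionLength A x + sectionLength B y ≤ sectionLength (A + B) (x + y) at h3
  nlinarith

theorem brunn_minkowski_prod {A B : Set (ℝ × ℝ)} (hA : IsOpen A) (hB : IsOpen B)
    (nA : A.Nonempty) (nB : B.Nonempty) (bA : Bornology.IsBounded A)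
    (bB : Bornology.IsBounded B) :
    (√(volume A).toReal + √(volume B).toReal) ^ 2 ≤ (volume (A + B)).toReal := by
  have h := bonnesen_inequality hA hB nA nB bA bB
  have hM := iSup_sectionLength_pos hA nA bA
  have hN := iSup_sectionLength_pos hB nB bB
  set M := ⨆ x, sectionLength A x
  set N := ⨆ x, sectionLength B x
  have hMN : 0 < M + N := by positivity
  have bAB : Bornology.IsBounded (A + B) := bA.add bB
  have fin : ∀ {C : Set (ℝ × ℝ)} {R : ℝ}, Bornology.IsBounded C → 0 < R →
      volume C / ENNReal.ofReal R ≠ ∞ := fun hC hR =>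
    (ENNReal.div_lt_top hC.measure_lt_top.ne (by simpa using hR)).ne
  have h' := ENNReal.toReal_mono (fin bAB hMN) h
  rw [ENNReal.toReal_add (fin bA hM) (fin bB hN)] at h'
  simp only [ENNReal.toReal_div, ENNReal.toReal_ofReal hM.le, ENNReal.toReal_ofReal hN.le,
    ENNReal.toReal_ofReal hMN.le] at h'
  have ha : 0 ≤ (volume A).toReal := ENNReal.toReal_nonneg
  have hb : 0 ≤ (volume B).toReal := ENNReal.toReal_nonneg
  set a := (volume A).toReal
  set b := (volume B).toReal
  rw [le_div_iff₀ hMN] at h'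
  refine le_trans ?_ h'
  have e1 : (a / M + b / N) * (M + N) = a + b + (a * N / M + b * M / N) := by
    field_simp
    ring
  have h5 : a * N / M = √(a * N / M) ^ 2 := (Real.sq_sqrt (by positivity)).symm
  have h6 : b * M / N = √(b * M / N) ^ 2 := (Real.sq_sqrt (by positivity)).symm
  have h7 : √(a * N / M) * √(b * M / N) = √a * √b := by
    rw [← Real.sqrt_mul (by positivity), ← Real.sqrt_mul ha]
    congr 1
    field_simp
  rw [e1, h5, h6]
  nlinarith [Real.sq_sqrt ha, Real.sq_sqrt hb, sq_nonneg (√(a * N / M) - √(b * M / N))]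

/-- The coordinate homeomorphism from the Euclidean plane to `ℝ × ℝ`. -/
def planeCoord : E2 ≃ₜ ℝ × ℝ where
  toFun x := (x 0, x 1)
  invFun y := !₂[y.1, y.2]
  left_inv x := by ext i; fin_cases i <;> rfl
  right_inv y := rfl
  continuous_toFun := by fun_prop
  continuous_invFun := by fun_prop

theorem measurePreserving_planeCoord : MeasurePreserving planeCoord :=
  (volume_preserving_finTwoArrow ℝ).comp (PiLp.volume_preserving_ofLp (Fin 2))

theorem brunn_minkowski {A B : Set E2} (hA : IsOpen A) (hB : IsOpen B)
    (nA : A.Nonempty) (nB : B.Nonempty) (bA : Bornology.IsBounded A)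
    (bB : Bornology.IsBounded B) :
    (√(volume A).toReal + √(volume B).toReal) ^ 2 ≤ (volume (A + B)).toReal := by
  have hvol : ∀ C : Set E2, IsOpen C → volume (planeCoord '' C) = volume C := by
    intro C hC
    rw [← measurePreserving_planeCoord.measure_preimage
      ((planeCoord.isOpenMap C hC).measurableSet.nullMeasurableSet),
      preimage_image_eq _ planeCoord.injective]
  have hbd : ∀ C : Set E2, Bornology.IsBounded C → Bornology.IsBounded (planeCoord '' C) := by
    intro C hC
    have := (hC.isCompact_closure.image planeCoord.continuous).isBounded
    exact this.subset (image_mono subset_closure)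
  have hadd : planeCoord '' (A + B) = planeCoord '' A + planeCoord '' B := by
    rw [← image2_add, ← image2_add, image_image2_distrib]
    intro a b
    rfl
  have := brunn_minkowski_prod (planeCoord.isOpenMap A hA) (planeCoord.isOpenMap B hB)
    (nA.image _) (nB.image _) (hbd A bA) (hbd B bB)
  rwa [← hadd, hvol A hA, hvol B hB, hvol _ hA.add_right] at this

theorem sqrt_volume_add_ball_sq_le {A : Set E2} (hA : IsOpen A) (nA : A.Nonempty)
    (bA : Bornology.IsBounded A) {h : ℝ} (hh : 0 < h) :
    (√(volume A).toReal + √π * h) ^ 2 ≤ (volume (A + Metric.ball 0 h)).toReal := by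
  have := brunn_minkowski hA Metric.isOpen_ball nA (Metric.nonempty_ball.2 hh) bA
    (Metric.isBounded_ball (x := (0 : E2)))
  rwa [EuclideanSpace.volume_ball_fin_two, ENNReal.toReal_mul, ENNReal.toReal_pow,
    ENNReal.toReal_ofReal hh.le, ENNReal.toReal_ofReal pi_pos.le, mul_comm,
    Real.sqrt_mul pi_pos.le, Real.sqrt_sq hh.le] at this

/-! ### Decreasing rearrangement in logarithmic coordinates -/

/-- The measure `A e^{-t} dt`, for which `(t, ∞)` has mass `A e^{-t}`. -/
def expMeas (A : ℝ) : Measure ℝ :=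
  volume.withDensity fun t => ENNReal.ofReal (A * rexp (-t))

theorem expMeas_Ioi {A : ℝ} (hA : 0 ≤ A) (t : ℝ) :
    expMeas A (Ioi t) = ENNReal.ofReal (A * rexp (-t)) := by
  rw [expMeas, withDensity_apply _ measurableSet_Ioi,
    ← ofReal_integral_eq_lintegral_ofReal ((integrableOn_exp_neg_Ioi t).const_mul A)
      (Eventually.of_forall fun s => by positivity),
    integral_const_mul, integral_exp_neg_Ioi]

/-- The rearrangement of `f`, as an increasing function of the logarithmic variable `t` for which
`A e^{-t}` is the measure of a superlevel set. -/
def rearr (A : ℝ) (f : E2 → ℝ) (t : ℝ) : ℝ :=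
  sSup {τ | 0 ≤ τ ∧ ENNReal.ofReal (A * rexp (-t)) < volume {x | τ < f x}}

section rearr

variable {A M : ℝ} {f g : E2 → ℝ}

theorem bddAbove_rearr_set (hM : ∀ x, f x ≤ M) (t : ℝ) :
    BddAbove {τ | 0 ≤ τ ∧ ENNReal.ofReal (A * rexp (-t)) < volume {x | τ < f x}} := by
  refine ⟨M, fun τ hτ => ?_⟩
  by_contra! h
  have : {x | τ < f x} = ∅ := by
    ext x
    simpa using (hM x).trans h.le
  simp [this] at hτ

theorem rearr_nonneg (t : ℝ) : 0 ≤ rearr A f t := Real.sSup_nonneg fun _ h => h.1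

theorem lt_rearr_iff (hM : ∀ x, f x ≤ M) {τ : ℝ} (hτ : 0 ≤ τ) (t : ℝ) :
    τ < rearr A f t ↔ ENNReal.ofReal (A * rexp (-t)) < volume {x | τ < f x} := by
  constructor
  · intro h
    have hne : {τ | 0 ≤ τ ∧ ENNReal.ofReal (A * rexp (-t)) < volume {x | τ < f x}}.Nonempty := by
      by_contra h0
      rw [not_nonempty_iff_eq_empty] at h0
      rw [rearr, h0, Real.sSup_empty] at h
      linarith
    obtain ⟨σ, hσ, hlt⟩ := exists_lt_of_lt_csSup hne h
    exact hσ.2.trans_le (measure_mono fun x (hx : σ < f x) => hlt.trans hx)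
  · intro h
    have hU : {x | τ < f x} = ⋃ n : ℕ, {x | τ + 1 / ((n : ℝ) + 1) < f x} := by
      ext x
      simp only [mem_ofPred_eq, mem_iUnion]
      constructor
      · intro hx
        obtain ⟨n, hn⟩ := exists_nat_one_div_lt (sub_pos.2 hx)
        exact ⟨n, by linarith⟩
      · rintro ⟨n, hn⟩
        have : (0 : ℝ) < 1 / ((n : ℝ) + 1) := by positivity
        linarith
    have hmono : Monotone fun n : ℕ => {x | τ + 1 / ((n : ℝ) + 1) < f x} := by
      intro m n hmn x hx
      simp only [mem_ofPred_eq] at hx ⊢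
      have := Nat.one_div_le_one_div (α := ℝ) hmn
      linarith
    rw [hU, hmono.measure_iUnion, lt_iSup_iff] at h
    obtain ⟨n, hn⟩ := h
    have hp : (0 : ℝ) < 1 / ((n : ℝ) + 1) := by positivity
    have : τ + 1 / ((n : ℝ) + 1) ≤ rearr A f t :=
      le_csSup (bddAbove_rearr_set hM t) ⟨by positivity, hn⟩
    linarith

theorem monotone_rearr (hA : 0 ≤ A) (hM : ∀ x, f x ≤ M) : Monotone (rearr A f) := by
  intro s t hst
  refine le_of_forall_lt fun c hc => ?_
  by_cases h0 : 0 ≤ c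
  · rw [lt_rearr_iff hM h0] at hc ⊢
    refine lt_of_le_of_lt (ENNReal.ofReal_le_ofReal ?_) hc
    gcongr
  · exact (not_le.1 h0).trans_le (rearr_nonneg t)

theorem setOf_lt_rearr (hA : 0 < A) (hM : ∀ x, f x ≤ M) {τ : ℝ} (hτ : 0 ≤ τ)
    (h0 : volume {x | τ < f x} ≠ 0) (hfin : volume {x | τ < f x} ≠ ∞) :
    {t | τ < rearr A f t} = Ioi (Real.log (A / (volume {x | τ < f x}).toReal)) := by
  ext t
  have hpos : 0 < (volume {x | τ < f x}).toReal := ENNReal.toReal_pos h0 hfin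
  simp only [mem_ofPred_eq, lt_rearr_iff hM hτ, mem_Ioi]
  rw [← ENNReal.ofReal_toReal hfin, ENNReal.ofReal_lt_ofReal_iff hpos,
    ENNReal.toReal_ofReal hpos.le, Real.log_lt_iff_lt_exp (by positivity), Real.exp_neg,
    ← div_eq_mul_inv, div_lt_comm₀ (Real.exp_pos t) hpos]

theorem expMeas_lt_rearr (hA : 0 < A) (hM : ∀ x, f x ≤ M) {τ : ℝ} (hτ : 0 ≤ τ)
    (hfin : volume {x | τ < f x} ≠ ∞) :
    expMeas A {t | τ < rearr A f t} = volume {x | τ < f x} := by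
  by_cases h0 : volume {x | τ < f x} = 0
  · have : {t | τ < rearr A f t} = ∅ := by
      ext t
      simp [lt_rearr_iff hM hτ, h0]
    rw [this, h0, measure_empty]
  · have hpos : 0 < (volume {x | τ < f x}).toReal := ENNReal.toReal_pos h0 hfin
    rw [setOf_lt_rearr hA hM hτ h0 hfin, expMeas_Ioi hA.le, Real.exp_neg,
      Real.exp_log (by positivity), inv_div, mul_div_cancel₀ _ hA.ne', ENNReal.ofReal_toReal hfin]

end rearr

theorem volume_triangle (p q : ℝ) :
    2 * volume {z : ℝ × ℝ | p ≤ z.1 ∧ z.1 < z.2 ∧ z.2 < q} = ENNReal.ofReal (max (q - p) 0 ^ 2) := by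
  have hm : MeasurableSet {z : ℝ × ℝ | p ≤ z.1 ∧ z.1 < z.2 ∧ z.2 < q} :=
    (measurableSet_le measurable_const measurable_fst).inter
      ((measurableSet_lt measurable_fst measurable_snd).inter
        (measurableSet_lt measurable_snd measurable_const))
  rw [Measure.volume_eq_prod, Measure.prod_apply hm]
  have hsec : ∀ a : ℝ, volume (Prod.mk a ⁻¹' {z : ℝ × ℝ | p ≤ z.1 ∧ z.1 < z.2 ∧ z.2 < q}) =
      (Icc p q).indicator (fun a => ENNReal.ofReal (q - a)) a := by
    intro a
    by_cases ha : a ∈ Icc p q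
    · rw [indicator_of_mem ha, ← Real.volume_Ioo]
      congr 1
      ext b
      simp [ha.1]
    · rw [indicator_of_notMem ha]
      have : Prod.mk a ⁻¹' {z : ℝ × ℝ | p ≤ z.1 ∧ z.1 < z.2 ∧ z.2 < q} = ∅ := by
        ext b
        simp only [mem_preimage, mem_ofPred_eq, mem_empty_iff_false, iff_false]
        rintro ⟨h1, h2, h3⟩
        exact ha ⟨h1, (h2.trans h3).le⟩
      rw [this, measure_empty]
  rw [lintegral_congr hsec, lintegral_indicator measurableSet_Icc]
  by_cases hpq : p ≤ q
  · have h_int : IntegrableOn (fun a => q - a) (Icc p q) :=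
      (continuous_const.sub continuous_id).continuousOn.integrableOn_Icc
    rw [← ofReal_integral_eq_lintegral_ofReal h_int
      ((ae_restrict_iff' measurableSet_Icc).2 (Eventually.of_forall fun a ha => by
        simpa using ha.2)), integral_Icc_eq_integral_Ioc, ← intervalIntegral.integral_of_le hpq]
    have : ∫ a in p..q, (q - a) = (q - p) ^ 2 / 2 := by
      rw [intervalIntegral.integral_sub (by simp) (by simp)]
      simp
      ring
    rw [this, max_eq_left (by linarith), ← ENNReal.ofReal_ofNat, ← ENNReal.ofReal_mul (by simp)]
    congr 1
    ring
  · rw [Icc_eq_empty hpq, Measure.restrict_empty, lintegral_zero_measure,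
      max_eq_right (by linarith)]
    simp

theorem lintegral_sq_posPart_sub {X : Type*} [MeasurableSpace X] (μ : Measure X) [SFinite μ]
    {f g : X → ℝ} (hf : Measurable f) (hg : Measurable g) :
    ∫⁻ x, ENNReal.ofReal (max (g x - f x) 0 ^ 2) ∂μ =
      2 * ∫⁻ z : ℝ × ℝ, μ {x | f x ≤ z.1 ∧ z.1 < z.2 ∧ z.2 < g x} := by
  have hm : MeasurableSet {w : X × ℝ × ℝ | f w.1 ≤ w.2.1 ∧ w.2.1 < w.2.2 ∧ w.2.2 < g w.1} :=
    (measurableSet_le (hf.comp measurable_fst) measurable_snd.fst).inter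
      ((measurableSet_lt measurable_snd.fst measurable_snd.snd).inter
        (measurableSet_lt measurable_snd.snd (hg.comp measurable_fst)))
  have h1 := Measure.prod_apply (μ := μ) (ν := (volume : Measure (ℝ × ℝ))) hm
  have h2 := Measure.prod_apply_symm (μ := μ) (ν := (volume : Measure (ℝ × ℝ))) hm
  calc _ = ∫⁻ x, 2 * volume {z : ℝ × ℝ | f x ≤ z.1 ∧ z.1 < z.2 ∧ z.2 < g x} ∂μ :=
        lintegral_congr fun x => (volume_triangle _ _).symm
    _ = 2 * ∫⁻ x, volume {z : ℝ × ℝ | f x ≤ z.1 ∧ z.1 < z.2 ∧ z.2 < g x} ∂μ :=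
        lintegral_const_mul' _ _ (by simp)
    _ = _ := by
        congr 1
        exact h1.symm.trans h2

instance (A : ℝ) : SFinite (expMeas A) := by
  unfold expMeas
  infer_instance

/-- Rearrangement does not increase the `L²` norm of the positive part of a difference. -/
theorem lintegral_sq_posPart_rearr_sub_le {A M : ℝ} {f g : E2 → ℝ} (hA : 0 < A)
    (hf : Measurable f) (hg : Measurable g)
    (hfM : ∀ x, f x ≤ M) (hgM : ∀ x, g x ≤ M)
    (hffin : volume {x | 0 < f x} ≠ ∞) (hgfin : volume {x | 0 < g x} ≠ ∞) :
    ∫⁻ t, ENNReal.ofReal (max (rearr A g t - rearr A f t) 0 ^ 2) ∂(expMeas A) ≤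
      ∫⁻ x, ENNReal.ofReal (max (g x - f x) 0 ^ 2) := by
  have mf := (monotone_rearr hA.le hfM).measurable
  have mg := (monotone_rearr hA.le hgM).measurable
  rw [lintegral_sq_posPart_sub _ mf mg, lintegral_sq_posPart_sub _ hf hg]
  gcongr with z
  obtain ⟨a, b⟩ := z
  simp only
  by_cases hab : a < b
  swap
  · simp [hab]
  by_cases ha : 0 ≤ a
  swap
  · have : {t | rearr A f t ≤ a ∧ a < b ∧ b < rearr A g t} = ∅ := by
      ext t
      simp only [mem_ofPred_eq, mem_empty_iff_false, iff_false]
      rintro ⟨h, -⟩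
      exact ha ((rearr_nonneg t).trans h)
    simp [this]
  have hb : 0 ≤ b := ha.trans hab.le
  have fin : ∀ {h : E2 → ℝ} {c : ℝ}, 0 ≤ c → volume {x | 0 < h x} ≠ ∞ →
      volume {x | c < h x} ≠ ∞ := fun hc hh =>
    ((measure_mono fun x hx => lt_of_le_of_lt hc hx).trans_lt hh.lt_top).ne
  have e1 : {t | rearr A f t ≤ a ∧ a < b ∧ b < rearr A g t} =
      {t | b < rearr A g t} \ {t | a < rearr A f t} := by
    ext t
    simp [hab, and_comm]
  have e2 : {x | f x ≤ a ∧ a < b ∧ b < g x} = {x | b < g x} \ {x | a < f x} := by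
    ext t
    simp [hab, and_comm]
  rw [e1, e2]
  refine le_trans ?_ le_measure_sdiff
  by_cases hle : volume {x | b < g x} ≤ volume {x | a < f x}
  · have : {t | b < rearr A g t} \ {t | a < rearr A f t} = ∅ := by
      rw [sdiff_eq_empty]
      intro t ht
      simp only [mem_ofPred_eq, lt_rearr_iff hgM hb, lt_rearr_iff hfM ha] at ht ⊢
      exact ht.trans_le hle
    simp [this]
  · have hsub : {t | a < rearr A f t} ⊆ {t | b < rearr A g t} := by
      intro t ht
      simp only [mem_ofPred_eq, lt_rearr_iff hgM hb, lt_rearr_iff hfM ha] at ht ⊢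
      exact ht.trans (not_le.1 hle)
    have hfa := expMeas_lt_rearr hA hfM ha (fin ha hffin)
    rw [measure_sdiff hsub (measurableSet_lt measurable_const mf).nullMeasurableSet
      (by rw [hfa]; exact fin ha hffin), hfa, expMeas_lt_rearr hA hgM hb (fin hb hgfin)]

instance (A : ℝ) : IsFiniteMeasure ((expMeas A).restrict (Ioi 0)) := by
  refine ⟨?_⟩
  rw [Measure.restrict_apply_univ, expMeas, withDensity_apply _ measurableSet_Ioi]
  exact (((integrableOn_exp_neg_Ioi 0).const_mul A).lintegral_lt_top)

theorem rearr_eq_zero {A M : ℝ} (hA : 0 ≤ A) {Ω : Set E2} (hΩ : volume Ω = ENNReal.ofReal A)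
    {f : E2 → ℝ} (hfM : ∀ x, f x ≤ M) (hfΩ : ∀ x, x ∉ Ω → f x = 0) {t : ℝ} (ht : t ≤ 0) :
    rearr A f t = 0 := by
  refine le_antisymm (not_lt.1 fun h => ?_) (rearr_nonneg t)
  rw [lt_rearr_iff hfM le_rfl] at h
  have h1 : volume {x | 0 < f x} ≤ ENNReal.ofReal A := by
    rw [← hΩ]
    refine measure_mono fun x hx => ?_
    by_contra hx'
    simp [hfΩ x hx'] at hx
  refine absurd (h.trans_le h1) (not_lt.2 (ENNReal.ofReal_le_ofReal ?_))
  nlinarith [Real.one_le_exp (x := -t) (by linarith)]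

/-- A function on `Ω` and its rearrangement have the same distribution. -/
theorem map_rearr {A M : ℝ} (hA : 0 < A) {Ω : Set E2}
    (hΩ : volume Ω = ENNReal.ofReal A) {f : E2 → ℝ} (hf : Measurable f) (hf0 : ∀ x, 0 ≤ f x)
    (hfM : ∀ x, f x ≤ M) (hfΩ : ∀ x, x ∉ Ω → f x = 0) :
    ((expMeas A).restrict (Ioi 0)).map (rearr A f) = (volume.restrict Ω).map f := by
  have mf := (monotone_rearr hA.le hfM).measurable
  have : IsFiniteMeasure (volume.restrict Ω) := ⟨by simp [hΩ]⟩
  have huniv : (expMeas A).restrict (Ioi 0) univ = volume.restrict Ω univ := by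
    rw [Measure.restrict_apply_univ, Measure.restrict_apply_univ, expMeas_Ioi hA.le, hΩ]
    simp
  refine Measure.ext_of_Iic _ _ fun a => ?_
  rw [Measure.map_apply mf measurableSet_Iic, Measure.map_apply hf measurableSet_Iic]
  by_cases ha : 0 ≤ a
  · have c1 : rearr A f ⁻¹' Iic a = {t | a < rearr A f t}ᶜ := by ext; simp
    have c2 : f ⁻¹' Iic a = {x | a < f x}ᶜ := by ext; simp
    have m1 : MeasurableSet {t | a < rearr A f t} := measurableSet_lt measurable_const mf
    have m2 : MeasurableSet {x | a < f x} := measurableSet_lt measurable_const hf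
    have s2 : {x | a < f x} ⊆ Ω := by
      intro x hx
      by_contra hx'
      simp only [mem_ofPred_eq, hfΩ x hx'] at hx
      linarith
    have s1 : {t | a < rearr A f t} ⊆ Ioi 0 := by
      intro t ht
      by_contra h
      simp only [mem_Ioi, not_lt] at h
      simp only [mem_ofPred_eq, rearr_eq_zero hA.le hΩ hfM hfΩ h] at ht
      linarith
    rw [c1, c2, measure_compl m1 (measure_ne_top _ _), measure_compl m2 (measure_ne_top _ _),
      huniv, Measure.restrict_apply m1, Measure.restrict_apply m2, inter_eq_left.2 s1,
      inter_eq_left.2 s2, expMeas_lt_rearr hA hfM ha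
        ((measure_mono s2).trans_lt (by simp [hΩ])).ne]
  · have c1 : rearr A f ⁻¹' Iic a = ∅ := by
      ext t
      simp only [mem_preimage, mem_Iic, mem_empty_iff_false, iff_false]
      exact fun h => ha ((rearr_nonneg t).trans h)
    have c2 : f ⁻¹' Iic a = ∅ := by
      ext t
      simp only [mem_preimage, mem_Iic, mem_empty_iff_false, iff_false]
      exact fun h => ha ((hf0 t).trans h)
    simp [c1, c2]

/-! ### The Pólya–Szegő inequality -/

theorem rearr_le_rearr_add {A M N h c t t' : ℝ} {f g : E2 → ℝ} (hA : 0 < A)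
    (hf : Continuous f) (hfb : Bornology.IsBounded {x | 0 < f x})
    (hfM : ∀ x, f x ≤ M) (hgN : ∀ x, g x ≤ N) (hh : 0 < h) (hc : 0 ≤ c)
    (hfg : ∀ x y, dist y x < h → f y ≤ g x + c)
    (htt' : √A * rexp (-t / 2) = √A * rexp (-t' / 2) + √π * h) :
    rearr A f t' ≤ rearr A g t + c := by
  refine le_of_forall_lt fun τ hτ => ?_
  by_cases hcτ : c ≤ τ
  swap
  · have := rearr_nonneg (A := A) (f := g) t
    linarith
  have hτ0 : 0 ≤ τ := hc.trans hcτ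
  have hsq : ∀ s : ℝ, A * rexp (-s) = (√A * rexp (-s / 2)) ^ 2 := by
    intro s
    rw [mul_pow, Real.sq_sqrt hA.le, ← Real.exp_nat_mul]
    congr 2
    push_cast
    ring
  rw [lt_rearr_iff hfM hτ0] at hτ
  have hopen : IsOpen {x | τ < f x} := isOpen_lt continuous_const hf
  have hbdd : Bornology.IsBounded {x | τ < f x} :=
    hfb.subset fun x (hx : τ < f x) => hτ0.trans_lt hx
  have hne : {x | τ < f x}.Nonempty := by
    rw [nonempty_iff_ne_empty]
    intro h0
    rw [h0, measure_empty] at hτ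
    exact not_lt_bot hτ
  have hBM := sqrt_volume_add_ball_sq_le hopen hne hbdd hh
  have hsub : {x | τ < f x} + Metric.ball 0 h ⊆ {x | τ - c < g x} := by
    rintro _ ⟨y, hy, b, hb, rfl⟩
    have : dist y (y + b) < h := by simpa [dist_eq_norm] using hb
    have := hfg _ _ this
    simp only [mem_ofPred_eq] at hy ⊢
    linarith
  have hlt : √A * rexp (-t' / 2) < √(volume {x | τ < f x}).toReal := by
    apply Real.lt_sqrt_of_sq_lt
    rw [← hsq]
    exact (ENNReal.ofReal_lt_iff_lt_toReal (by positivity) hbdd.measure_lt_top.ne).1 hτ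
  have h2 : τ - c < rearr A g t := by
    rw [lt_rearr_iff hgN (sub_nonneg.2 hcτ)]
    refine lt_of_lt_of_le ?_ (measure_mono hsub)
    rw [ENNReal.ofReal_lt_iff_lt_toReal (by positivity)
      (hbdd.add Metric.isBounded_ball).measure_lt_top.ne]
    refine lt_of_lt_of_le ?_ hBM
    rw [hsq, htt']
    have : 0 < √A * rexp (-t' / 2) := by positivity
    gcongr
  linarith

section smooth

variable {u : E2 → ℝ}

theorem HasCompactSupport.isBounded_setOf_abs_pos (hc : HasCompactSupport u) :
    Bornology.IsBounded {x | 0 < |u x|} :=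
  hc.isBounded.subset fun x hx => subset_tsupport u (by simpa using hx)

theorem exists_abs_le (hu : Continuous u) (hc : HasCompactSupport u) : ∃ M, ∀ x, |u x| ≤ M :=
  hu.bounded_above_of_compact_support hc

theorem exists_lipschitzOnWith_rearr {A : ℝ} (hA : 0 < A) (hu : ContDiff ℝ (⊤ : ℕ∞) u)
    (hc : HasCompactSupport u) :
    ∃ K, LipschitzOnWith K (rearr A fun x => |u x|) (Ici 0) := by
  obtain ⟨L, hL⟩ := ContDiff.lipschitzWith_of_hasCompactSupport hc hu (by simp)
  obtain ⟨M, hM⟩ := exists_abs_le hu.continuous hc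
  have hmono := monotone_rearr hA.le hM
  have key : ∀ s t : ℝ, 0 ≤ s → s < t → rearr A (fun x => |u x|) t ≤
      rearr A (fun x => |u x|) s + L * (√A / √π / 2) * (t - s) := by
    intro s t hs hst
    have hlt : rexp (-t / 2) < rexp (-s / 2) := Real.exp_lt_exp.2 (by linarith)
    have hpi : 0 < √π := Real.sqrt_pos.2 pi_pos
    have hsA : 0 < √A := Real.sqrt_pos.2 hA
    have h1 := rearr_le_rearr_add (A := A) (f := fun x => |u x|) (g := fun x => |u x|)
      (h := √A / √π * (rexp (-s / 2) - rexp (-t / 2)))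
      (c := L * (√A / √π * (rexp (-s / 2) - rexp (-t / 2)))) (t := s) (t' := t) hA
      hu.continuous.abs hc.isBounded_setOf_abs_pos hM hM
      (mul_pos (by positivity) (sub_pos.2 hlt))
      (mul_nonneg L.2 (mul_nonneg (by positivity) (sub_pos.2 hlt).le))
      (fun x y hxy => by
        have := hL.dist_le_mul y x
        have h3 : |u y| - |u x| ≤ dist (u y) (u x) := abs_sub_abs_le_abs_sub _ _
        have h4 : (L : ℝ) * dist y x ≤ L * (√A / √π * (rexp (-s / 2) - rexp (-t / 2))) :=
          mul_le_mul_of_nonneg_left hxy.le L.2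
        linarith)
      (by field_simp; ring)
    refine h1.trans ?_
    have h5 : rexp (-s / 2) - rexp (-t / 2) ≤ (t - s) / 2 := by
      have e : rexp (-t / 2) = rexp (-s / 2) * rexp (-(t - s) / 2) := by
        rw [← Real.exp_add]
        ring_nf
      have e1 : rexp (-s / 2) ≤ 1 := Real.exp_le_one_iff.2 (by linarith)
      have e2 := Real.add_one_le_exp (-(t - s) / 2)
      have e3 := Real.exp_pos (-s / 2)
      rw [e]
      nlinarith
    have h6 : L * (√A / √π * (rexp (-s / 2) - rexp (-t / 2))) ≤
        L * (√A / √π * ((t - s) / 2)) := by gcongr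
    linarith
  refine ⟨(L * (√A / √π / 2)).toNNReal, LipschitzOnWith.of_dist_le_mul fun x hx y hy => ?_⟩
  have hC : (0 : ℝ) ≤ L * (√A / √π / 2) := by positivity
  rw [Real.coe_toNNReal _ hC]
  rcases lt_trichotomy x y with h | h | h
  · have := key x y hx h
    rw [dist_comm, Real.dist_eq, dist_comm, Real.dist_eq,
      abs_of_nonneg (sub_nonneg.2 (hmono h.le)), abs_of_pos (sub_pos.2 h)]
    linarith
  · simp [h]
  · have := key y x hy h
    rw [Real.dist_eq, Real.dist_eq,
      abs_of_nonneg (sub_nonneg.2 (hmono h.le)), abs_of_pos (sub_pos.2 h)]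
    linarith

/-- Limit of the difference quotients of `W` along the shift that changes the radius by `h`. -/
theorem tendsto_shift_quotient {W : ℝ → ℝ} {t b : ℝ} (hW : DifferentiableAt ℝ W t) :
    Tendsto (fun h : ℝ => h⁻¹ * (W (-2 * Real.log (rexp (-t / 2) - b * h)) - W t)) (𝓝[>] 0)
      (𝓝 (deriv W t * (2 * b * rexp (t / 2)))) := by
  have h0 : -2 * Real.log (rexp (-t / 2) - b * 0) = t := by
    rw [mul_zero, sub_zero, Real.log_exp]
    ring
  have h1 : HasDerivAt (fun h : ℝ => rexp (-t / 2) - b * h) (-b) 0 := by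
    simpa using ((hasDerivAt_id (0 : ℝ)).const_mul b).const_sub (rexp (-t / 2))
  have h2 : HasDerivAt (fun h : ℝ => -2 * Real.log (rexp (-t / 2) - b * h))
      (2 * b * rexp (t / 2)) 0 := by
    have := (h1.log (by simp [Real.exp_ne_zero])).const_mul (-2)
    have e : -2 * (-b / (rexp (-t / 2) - b * 0)) = 2 * b * rexp (t / 2) := by
      rw [mul_zero, sub_zero, neg_div 2 t, Real.exp_neg]
      field_simp
    rwa [e] at this
  have h3 : HasDerivAt (fun h : ℝ => W (-2 * Real.log (rexp (-t / 2) - b * h)))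
      (deriv W t * (2 * b * rexp (t / 2))) 0 := by
    have hW' : HasDerivAt W (deriv W t) (-2 * Real.log (rexp (-t / 2) - b * 0)) := by
      rw [h0]
      exact hW.hasDerivAt
    exact hW'.comp 0 h2
  have := h3.tendsto_slope_zero_right
  simpa only [zero_add, h0, smul_eq_mul] using this

theorem lintegral_expMeas_sq {A : ℝ} (hA : 0 < A) (φ : ℝ → ℝ) :
    ∫⁻ t, ENNReal.ofReal ((φ t * (2 * (√π / √A) * rexp (t / 2))) ^ 2) ∂(expMeas A) =
      ∫⁻ t, ENNReal.ofReal (4 * π * φ t ^ 2) := by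
  rw [expMeas, lintegral_withDensity_eq_lintegral_mul_non_measurable _ (by fun_prop)
    (Eventually.of_forall fun t => ENNReal.ofReal_lt_top)]
  refine lintegral_congr fun t => ?_
  rw [Pi.mul_apply, ← ENNReal.ofReal_mul (by positivity)]
  congr 1
  have e1 : rexp (t / 2) ^ 2 = rexp t := by
    rw [← Real.exp_nat_mul]
    congr 1
    push_cast
    ring
  have e2 : rexp (-t) * rexp t = 1 := by rw [← Real.exp_add]; simp
  have : A * rexp (-t) * (φ t * (2 * (√π / √A) * rexp (t / 2))) ^ 2 =
      A * (√π ^ 2 / √A ^ 2) * 4 * φ t ^ 2 * (rexp (-t) * rexp (t / 2) ^ 2) := by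
    field_simp
    ring
  rw [this, e1, e2, Real.sq_sqrt pi_pos.le, Real.sq_sqrt hA.le]
  field_simp

theorem exists_abs_le_add_of_dist_lt (hu : ContDiff ℝ (⊤ : ℕ∞) u) (hc : HasCompactSupport u)
    {ε : ℝ} (hε : 0 < ε) :
    ∃ δ > 0, ∀ h, h < δ → ∀ x y, dist y x < h → |u y| ≤ |u x| + h *
      (‖fderiv ℝ u x‖ + (Metric.cthickening 1 (tsupport u)).indicator (fun _ => ε) x) := by
  have hcont : Continuous (fderiv ℝ u) := hu.continuous_fderiv (by simp)
  have huc := (hc.fderiv (𝕜 := ℝ)).uniformContinuous_of_continuous hcont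
  obtain ⟨δ, hδ, hδ'⟩ := Metric.uniformContinuous_iff.1 huc ε hε
  refine ⟨min δ 1, by positivity, fun h hh x y hxy => ?_⟩
  have h1 : h < δ := hh.trans_le (min_le_left _ _)
  have h2 : h < 1 := hh.trans_le (min_le_right _ _)
  have hpos : 0 < h := dist_nonneg.trans_lt hxy
  by_cases hx : x ∈ Metric.cthickening 1 (tsupport u)
  · rw [indicator_of_mem hx]
    have hmv : ‖u y - u x‖ ≤ (‖fderiv ℝ u x‖ + ε) * ‖y - x‖ := by
      refine (convex_ball x h).norm_image_sub_le_of_norm_fderiv_le (𝕜 := ℝ)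
        (fun z _ => (hu.differentiable (by simp)) z) (fun z hz => ?_)
        (Metric.mem_ball_self hpos) hxy
      have := hδ' ((Metric.mem_ball.1 hz).trans h1)
      rw [dist_eq_norm] at this
      have := norm_le_insert' (fderiv ℝ u z) (fderiv ℝ u x)
      linarith
    have h3 : |u y| - |u x| ≤ ‖u y - u x‖ := abs_sub_abs_le_abs_sub _ _
    rw [← dist_eq_norm y x] at hmv
    have h4 : (‖fderiv ℝ u x‖ + ε) * dist y x ≤ (‖fderiv ℝ u x‖ + ε) * h := by gcongr
    linarith
  · rw [indicator_of_notMem hx]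
    have hy : y ∉ tsupport u := by
      intro hy
      refine hx (Metric.mem_cthickening_of_dist_le x y 1 _ hy ?_)
      rw [dist_comm]
      linarith
    rw [image_eq_zero_of_notMem_tsupport hy, abs_zero]
    positivity

theorem lintegral_deriv_rearr_sq_le_of_pos {A : ℝ} (hA : 0 < A) (hu : ContDiff ℝ (⊤ : ℕ∞) u)
    (hc : HasCompactSupport u) {ε : ℝ} (hε : 0 < ε) :
    ∫⁻ t, ENNReal.ofReal (4 * π * deriv (rearr A fun x => |u x|) t ^ 2) ≤
      ∫⁻ x, ENNReal.ofReal ((‖fderiv ℝ u x‖ +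
        (Metric.cthickening 1 (tsupport u)).indicator (fun _ => ε) x) ^ 2) := by
  obtain ⟨M, hM⟩ := exists_abs_le hu.continuous hc
  obtain ⟨δ, hδ, hstep⟩ := exists_abs_le_add_of_dist_lt hu hc hε
  have hcont : Continuous (fderiv ℝ u) := hu.continuous_fderiv (by simp)
  obtain ⟨G, hG⟩ := hcont.bounded_above_of_compact_support (hc.fderiv (𝕜 := ℝ))
  set K := Metric.cthickening 1 (tsupport u) with hK
  have hKc : IsCompact K := IsCompact.cthickening hc
  set D : E2 → ℝ := fun x => ‖fderiv ℝ u x‖ + K.indicator (fun _ => ε) x with hD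
  have hind0 : ∀ x, 0 ≤ K.indicator (fun _ => ε) x := fun x =>
    indicator_nonneg (fun _ _ => hε.le) x
  have hindε : ∀ x, K.indicator (fun _ => ε) x ≤ ε := fun x =>
    indicator_le_self' (fun _ _ => hε.le) x
  have hD0 : ∀ x, 0 ≤ D x := fun x => add_nonneg (norm_nonneg _) (hind0 x)
  have hDm : Measurable D :=
    hcont.norm.measurable.add (measurable_const.indicator hKc.measurableSet)
  have hsK : tsupport u ⊆ K := Metric.self_subset_cthickening _
  have hDK : ∀ x, x ∉ K → D x = 0 := by
    intro x hx
    have : fderiv ℝ u x = 0 :=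
      image_eq_zero_of_notMem_tsupport fun h => hx (hsK (tsupport_fderiv_subset ℝ h))
    simp [hD, this, hx]
  set f : E2 → ℝ := fun x => |u x| with hf
  have hfm : Measurable f := hu.continuous.abs.measurable
  set W := rearr A f with hW
  have hWmono : Monotone W := monotone_rearr hA.le hM
  set hn : ℕ → ℝ := fun n => δ / (n + 2) with hhn
  have hnpos : ∀ n, 0 < hn n := fun n => by positivity
  have hnδ : ∀ n, hn n < δ := fun n => by
    rw [hhn]
    simp only
    rw [div_lt_iff₀ (by positivity)]
    nlinarith [(Nat.cast_nonneg n : (0 : ℝ) ≤ n)]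
  have hnlim : Tendsto hn atTop (𝓝[>] 0) := by
    refine tendsto_nhdsWithin_iff.2 ⟨?_, Eventually.of_forall hnpos⟩
    have : Tendsto (fun n : ℕ => (n : ℝ) + 2) atTop atTop :=
      tendsto_atTop_add_const_right _ _ tendsto_natCast_atTop_atTop
    exact this.const_div_atTop δ
  set g : ℕ → E2 → ℝ := fun n x => f x + hn n * D x with hg
  have hgm : ∀ n, Measurable (g n) := fun n => hfm.add (hDm.const_mul _)
  have hgM : ∀ n x, g n x ≤ M + hn n * (G + ε) := fun n x => by
    have h1 := hM x
    have h2 : D x ≤ G + ε := add_le_add (hG x) (hindε x)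
    have := mul_le_mul_of_nonneg_left h2 (hnpos n).le
    simp only [hg, hf]
    linarith
  have hgMmono : ∀ n, Monotone (rearr A (g n)) := fun n => monotone_rearr hA.le (hgM n)
  have hffin : volume {x | 0 < f x} ≠ ∞ := (hc.isBounded_setOf_abs_pos).measure_lt_top.ne
  have hgfin : ∀ n, volume {x | 0 < g n x} ≠ ∞ := fun n => by
    refine ((measure_mono (t := K) fun x hx => ?_).trans_lt hKc.measure_lt_top).ne
    by_contra hxK
    have : u x = 0 := image_eq_zero_of_notMem_tsupport fun h => hxK (hsK h)
    simp [hg, hf, this, hDK x hxK] at hx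
  -- the contraction property, divided by the square of the step
  have hcontr : ∀ n, ∫⁻ t, ENNReal.ofReal
      (((hn n)⁻¹ * max (rearr A (g n) t - W t) 0) ^ 2) ∂(expMeas A) ≤
      ∫⁻ x, ENNReal.ofReal (D x ^ 2) := by
    intro n
    have h1 := lintegral_sq_posPart_rearr_sub_le (M := max M (M + hn n * (G + ε))) hA hfm (hgm n)
      (fun x => (hM x).trans (le_max_left _ _)) (fun x => (hgM n x).trans (le_max_right _ _))
      hffin (hgfin n)
    have h2 : ∀ x, ENNReal.ofReal (max (g n x - f x) 0 ^ 2) =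
        ENNReal.ofReal (hn n ^ 2) * ENNReal.ofReal (D x ^ 2) := by
      intro x
      rw [← ENNReal.ofReal_mul (by positivity)]
      simp only [hg, add_sub_cancel_left]
      rw [max_eq_left (mul_nonneg (hnpos n).le (hD0 x)), mul_pow]
    rw [lintegral_congr h2, lintegral_const_mul' _ _ ENNReal.ofReal_ne_top] at h1
    simp_rw [mul_pow, ENNReal.ofReal_mul (sq_nonneg (hn n)⁻¹)]
    rw [lintegral_const_mul' _ _ ENNReal.ofReal_ne_top]
    refine (mul_le_mul_right h1 _).trans ?_
    rw [← mul_assoc, ← ENNReal.ofReal_mul (by positivity), ← mul_pow,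
      inv_mul_cancel₀ (hnpos n).ne']
    simp
  have hlim : ∀ᵐ t ∂(expMeas A), ENNReal.ofReal
      ((deriv W t * (2 * (√π / √A) * rexp (t / 2))) ^ 2) ≤
      liminf (fun n => ENNReal.ofReal (((hn n)⁻¹ * max (rearr A (g n) t - W t) 0) ^ 2)) atTop := by
    have hac : expMeas A ≪ volume := withDensity_absolutelyContinuous _ _
    refine hac.ae_le ?_
    filter_upwards [hWmono.ae_differentiableAt] with t ht
    have hT := (tendsto_shift_quotient (b := √π / √A) ht).comp hnlim
    have hT2 := (ENNReal.continuous_ofReal.tendsto _).comp (hT.pow 2)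
    rw [← hT2.liminf_eq]
    refine liminf_le_liminf ?_
    have hev : ∀ᶠ n in atTop, √π / √A * hn n < rexp (-t / 2) := by
      have : Tendsto (fun n => √π / √A * hn n) atTop (𝓝 (√π / √A * 0)) :=
        (hnlim.mono_right nhdsWithin_le_nhds).const_mul _
      rw [mul_zero] at this
      exact this.eventually_lt_const (Real.exp_pos _)
    filter_upwards [hev] with n hn'
    simp only [Function.comp_apply]
    refine ENNReal.ofReal_le_ofReal ?_
    set t' := -2 * Real.log (rexp (-t / 2) - √π / √A * hn n) with ht'
    have hexp : rexp (-t' / 2) = rexp (-t / 2) - √π / √A * hn n := by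
      have : -t' / 2 = Real.log (rexp (-t / 2) - √π / √A * hn n) := by
        rw [ht']
        ring
      rw [this, Real.exp_log (by linarith)]
    have htt' : t ≤ t' := by
      have h1 : rexp (-t' / 2) ≤ rexp (-t / 2) := by
        rw [hexp]
        have := mul_nonneg (show (0 : ℝ) ≤ √π / √A by positivity) (hnpos n).le
        linarith
      have := Real.exp_le_exp.1 h1
      linarith
    have hle : W t' ≤ rearr A (g n) t + 0 := by
      refine rearr_le_rearr_add hA hu.continuous.abs hc.isBounded_setOf_abs_pos hM (hgM n)
        (hnpos n) le_rfl (fun x y hxy => ?_) ?_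
      · rw [add_zero]
        exact hstep _ (hnδ n) x y hxy
      · rw [hexp]
        have : √A ≠ 0 := (Real.sqrt_pos.2 hA).ne'
        field_simp
        ring
    have h0 : 0 ≤ W t' - W t := sub_nonneg.2 (hWmono htt')
    have h1 : W t' - W t ≤ max (rearr A (g n) t - W t) 0 := le_max_of_le_left (by linarith)
    have := inv_nonneg.2 (hnpos n).le
    gcongr
  calc _ = ∫⁻ t, ENNReal.ofReal
        ((deriv W t * (2 * (√π / √A) * rexp (t / 2))) ^ 2) ∂(expMeas A) :=
        (lintegral_expMeas_sq hA _).symm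
    _ ≤ ∫⁻ t, liminf (fun n => ENNReal.ofReal
          (((hn n)⁻¹ * max (rearr A (g n) t - W t) 0) ^ 2)) atTop ∂(expMeas A) :=
        lintegral_mono_ae hlim
    _ ≤ liminf (fun n => ∫⁻ t, ENNReal.ofReal
          (((hn n)⁻¹ * max (rearr A (g n) t - W t) 0) ^ 2) ∂(expMeas A)) atTop := by
        refine lintegral_liminf_le fun n => ?_
        have := (hgMmono n).measurable
        have := hWmono.measurable
        fun_prop
    _ ≤ liminf (fun _ : ℕ => ∫⁻ x, ENNReal.ofReal (D x ^ 2)) atTop :=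
        liminf_le_liminf (Eventually.of_forall hcontr)
    _ = _ := liminf_const _

/-- The Pólya–Szegő inequality, for the rearrangement in logarithmic coordinates. -/
theorem lintegral_deriv_rearr_sq_le {A : ℝ} (hA : 0 < A) (hu : ContDiff ℝ (⊤ : ℕ∞) u)
    (hc : HasCompactSupport u) :
    ∫⁻ t, ENNReal.ofReal (4 * π * deriv (rearr A fun x => |u x|) t ^ 2) ≤
      ∫⁻ x, ENNReal.ofReal (‖fderiv ℝ u x‖ ^ 2) := by
  have hcont : Continuous (fderiv ℝ u) := hu.continuous_fderiv (by simp)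
  obtain ⟨G, hG⟩ := hcont.bounded_above_of_compact_support (hc.fderiv (𝕜 := ℝ))
  have hG0 : 0 ≤ G := (norm_nonneg _).trans (hG 0)
  set K := Metric.cthickening 1 (tsupport u) with hK
  have hKc : IsCompact K := IsCompact.cthickening hc
  refine ENNReal.le_of_forall_pos_le_add fun η hη _ => ?_
  set C : ℝ := (2 * G + 1) * (volume K).toReal + 1 with hC
  have hCpos : 0 < C := by positivity
  have hη' : (0 : ℝ) < η := hη
  set ε : ℝ := min 1 (η / C) with hε
  have hεpos : 0 < ε := by positivity
  have hε1 : ε ≤ 1 := min_le_left _ _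
  refine (lintegral_deriv_rearr_sq_le_of_pos hA hu hc hεpos).trans ?_
  calc _ ≤ ∫⁻ x, (ENNReal.ofReal (‖fderiv ℝ u x‖ ^ 2) +
        K.indicator (fun _ => ENNReal.ofReal (ε * (2 * G + 1))) x) := by
        refine lintegral_mono fun x => ?_
        by_cases hx : x ∈ K
        · simp only [← hK, indicator_of_mem hx]
          rw [← ENNReal.ofReal_add (by positivity) (by positivity)]
          refine ENNReal.ofReal_le_ofReal ?_
          nlinarith [hG x, norm_nonneg (fderiv ℝ u x)]
        · simp only [← hK, indicator_of_notMem hx]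
          simp
    _ = (∫⁻ x, ENNReal.ofReal (‖fderiv ℝ u x‖ ^ 2)) +
        ENNReal.ofReal (ε * (2 * G + 1)) * volume K := by
        rw [lintegral_add_left (by fun_prop), lintegral_indicator hKc.measurableSet,
          setLIntegral_const]
    _ ≤ _ := by
        gcongr
        rw [← ENNReal.ofReal_toReal hKc.measure_lt_top.ne, ← ENNReal.ofReal_mul (by positivity)]
        refine ENNReal.ofReal_le_of_le_toReal ?_
        rw [ENNReal.coe_toReal]
        have h1 : ε * C ≤ η := by
          calc ε * C ≤ η / C * C := by gcongr; exact min_le_right _ _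
            _ = η := by field_simp
        have : ε * (2 * G + 1) * (volume K).toReal ≤ ε * C := by
          rw [hC]
          nlinarith
        linarith

end smooth

/-! ### Radial test functions on the disk -/

theorem IsTestFun.memLp {Ω : Set E2} {u : E2 → ℝ} (hu : IsTestFun Ω u) (q : ℝ≥0∞)
    (μ : Measure E2) [IsFiniteMeasureOnCompacts μ] : MemLp u q μ :=
  hu.1.continuous.memLp_of_hasCompactSupport hu.2.1

theorem integral_abs_rpow_eq {X : Type*} [MeasurableSpace X] {μ : Measure X} {u : X → ℝ} {p : ℝ}
    (hp : 0 < p) (hu : MemLp u (ENNReal.ofReal p) μ) (q : ℝ) :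
    (∫ x, |u x| ^ p ∂μ) ^ (q / p) = (eLpNorm u (ENNReal.ofReal p) μ).toReal ^ q := by
  rw [hu.eLpNorm_eq_integral_rpow_norm (by simpa using hp) (by simp),
    ENNReal.toReal_ofReal hp.le, ENNReal.toReal_ofReal (by positivity), ← Real.rpow_mul
      (integral_nonneg fun x => by positivity)]
  simp only [Real.norm_eq_abs]
  congr 1
  ring

theorem lambdaP_nonneg (Ω : Set E2) (p : ℝ) : 0 ≤ lambdaP Ω p := by
  refine Real.sInf_nonneg ?_
  rintro c ⟨u, -, -, rfl⟩
  exact integral_nonneg fun x => by positivity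

theorem lambdaP_mul_sq_le {Ω : Set E2} {p : ℝ} (hp : 0 < p) {u : E2 → ℝ}
    (hu : IsTestFun (symDisk Ω) u) :
    lambdaP Ω p * (eLpNorm u (ENNReal.ofReal p) (volume.restrict (symDisk Ω))).toReal ^ 2 ≤
      ∫ x in symDisk Ω, ‖fderiv ℝ u x‖ ^ 2 := by
  set n := (eLpNorm u (ENNReal.ofReal p) (volume.restrict (symDisk Ω))).toReal with hn
  have hn0 : 0 ≤ n := ENNReal.toReal_nonneg
  rcases hn0.eq_or_lt with h0 | hpos
  · rw [← h0]
    simp only [ne_eq, OfNat.ofNat_ne_zero, not_false_eq_true, zero_pow, mul_zero]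
    exact integral_nonneg fun x => by positivity
  have hv : IsTestFun (symDisk Ω) (n⁻¹ • u) := by
    refine ⟨contDiff_const.smul hu.1, hu.2.1.of_isClosed_subset (isClosed_tsupport _) ?_, ?_⟩
    · exact tsupport_smul_subset_right (fun _ => n⁻¹) u
    · exact (tsupport_smul_subset_right (fun _ => n⁻¹) u).trans hu.2.2
  have hmem : (∫ x in symDisk Ω, ‖fderiv ℝ (n⁻¹ • u) x‖ ^ 2) ∈ {c : ℝ | ∃ u : E2 → ℝ,
      IsTestFun (symDisk Ω) u ∧ (∫ x in symDisk Ω, |u x| ^ p) ^ (1 / p) = 1 ∧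
      c = ∫ x in symDisk Ω, ‖fderiv ℝ u x‖ ^ 2} := by
    refine ⟨_, hv, ?_, rfl⟩
    rw [integral_abs_rpow_eq hp (hv.memLp _ _), Real.rpow_one, eLpNorm_const_smul,
      ENNReal.toReal_mul, ← hn]
    simp [abs_of_pos hpos, hpos.ne']
  have hle : lambdaP Ω p ≤ ∫ x in symDisk Ω, ‖fderiv ℝ (n⁻¹ • u) x‖ ^ 2 := by
    refine csInf_le ⟨0, ?_⟩ hmem
    rintro c ⟨u, -, -, rfl⟩
    exact integral_nonneg fun x => by positivity
  have heq : ∀ x, ‖fderiv ℝ (n⁻¹ • u) x‖ ^ 2 = (n⁻¹) ^ 2 * ‖fderiv ℝ u x‖ ^ 2 := by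
    intro x
    rw [fderiv_const_smul ((hu.1.differentiable (by simp)) x), norm_smul, mul_pow]
    simp
  simp_rw [heq] at hle
  rw [integral_const_mul] at hle
  calc _ ≤ ((n⁻¹) ^ 2 * ∫ x in symDisk Ω, ‖fderiv ℝ u x‖ ^ 2) * n ^ 2 := by gcongr
    _ = _ := by field_simp

/-- The logarithmic radial coordinate `2 log (R / |x|)`. -/
def logRadius (R : ℝ) (x : E2) : ℝ := Real.log (R ^ 2) - Real.log (‖x‖ ^ 2)

theorem measurable_logRadius (R : ℝ) : Measurable (logRadius R) := by
  unfold logRadius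
  fun_prop

theorem lt_logRadius_iff {R : ℝ} (hR : 0 < R) {x : E2} (hx : x ≠ 0) (t : ℝ) :
    t < logRadius R x ↔ ‖x‖ < R * rexp (-t / 2) := by
  have hx' : 0 < ‖x‖ := norm_pos_iff.2 hx
  rw [logRadius, Real.log_pow, Real.log_pow, ← Real.log_lt_log_iff hx' (by positivity),
    Real.log_mul hR.ne' (Real.exp_ne_zero _), Real.log_exp]
  push_cast
  constructor <;> intro h <;> linarith

theorem exp_logRadius {R : ℝ} (hR : 0 < R) {x : E2} (hx : x ≠ 0) :
    rexp (logRadius R x) = R ^ 2 / ‖x‖ ^ 2 := by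
  have hx' : 0 < ‖x‖ := norm_pos_iff.2 hx
  rw [logRadius, Real.exp_sub, Real.exp_log (by positivity), Real.exp_log (by positivity)]

theorem map_logRadius {A R : ℝ} (hR : 0 < R) (hA : A = π * R ^ 2) :
    (volume.restrict (Metric.ball (0 : E2) R)).map (logRadius R) =
      (expMeas A).restrict (Ioi 0) := by
  have hA0 : 0 ≤ A := by rw [hA]; positivity
  have hball : ∀ r : ℝ, 0 ≤ r → volume (Metric.ball (0 : E2) r) = ENNReal.ofReal (π * r ^ 2) := by
    intro r hr
    rw [EuclideanSpace.volume_ball_fin_two, ENNReal.ofReal_mul pi_pos.le, ENNReal.ofReal_pow hr,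
      mul_comm]
  have : IsFiniteMeasure (volume.restrict (Metric.ball (0 : E2) R)) :=
    ⟨by simp [hball R hR.le]⟩
  have h0 : ∀ᵐ x : E2, x ≠ 0 := by simp [ae_iff]
  refine Measure.ext_of_Iic _ _ fun a => ?_
  rw [Measure.map_apply (measurable_logRadius R) measurableSet_Iic]
  by_cases ha : 0 ≤ a
  · have c1 : logRadius R ⁻¹' Iic a = {x | a < logRadius R x}ᶜ := by ext; simp
    have m1 : MeasurableSet {x | a < logRadius R x} :=
      measurableSet_lt measurable_const (measurable_logRadius R)
    rw [c1, ← compl_Ioi, measure_compl m1 (measure_ne_top _ _),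
      measure_compl measurableSet_Ioi (measure_ne_top _ _), Measure.restrict_apply_univ,
      Measure.restrict_apply_univ, expMeas_Ioi hA0, hball R hR.le,
      Measure.restrict_apply measurableSet_Ioi, inter_eq_left.2 (Ioi_subset_Ioi ha),
      expMeas_Ioi hA0, Measure.restrict_apply m1]
    have e1 : volume ({x | a < logRadius R x} ∩ Metric.ball 0 R) =
        volume (Metric.ball (0 : E2) (R * rexp (-a / 2))) := by
      refine measure_congr ?_
      filter_upwards [h0] with x hx
      simp only [eq_iff_iff]
      change (a < logRadius R x ∧ x ∈ Metric.ball 0 R) ↔ x ∈ Metric.ball 0 _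
      rw [lt_logRadius_iff hR hx, mem_ball_zero_iff, mem_ball_zero_iff]
      refine ⟨fun h => h.1, fun h => ⟨h, h.trans_le ?_⟩⟩
      have : rexp (-a / 2) ≤ 1 := Real.exp_le_one_iff.2 (by linarith)
      nlinarith
    rw [e1, hball _ (by positivity), hA]
    have : (R * rexp (-a / 2)) ^ 2 = R ^ 2 * rexp (-a) := by
      rw [mul_pow, ← Real.exp_nat_mul]
      congr 2
      push_cast
      ring
    rw [this, neg_zero, Real.exp_zero]
    ring_nf
  · have e1 : (expMeas A).restrict (Ioi 0) (Iic a) = 0 := by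
      rw [Measure.restrict_apply measurableSet_Iic]
      have : Iic a ∩ Ioi 0 = ∅ := by
        ext t
        simp only [mem_inter_iff, mem_Iic, mem_Ioi, mem_empty_iff_false, iff_false, not_and]
        intro h1 h2
        linarith
      simp [this]
    rw [e1, Measure.restrict_apply (measurable_logRadius R measurableSet_Iic)]
    refine measure_mono_null (t := {0}) ?_ (by simp)
    rintro x ⟨hx1, hx2⟩
    by_contra hx
    have h1 : a < logRadius R x := by
      rw [lt_logRadius_iff hR hx]
      refine (mem_ball_zero_iff.1 hx2).trans_le ?_
      have : 1 ≤ rexp (-a / 2) := Real.one_le_exp (by linarith)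
      nlinarith
    exact not_lt.2 hx1 h1

/-- The radial function on the plane with profile `F` in the logarithmic radial coordinate. -/
def radialFun (R c : ℝ) (F : ℝ → ℝ) (x : E2) : ℝ :=
  open scoped Classical in if x = 0 then c else F (logRadius R x)

section radial

variable {R δ N : ℝ} {F : ℝ → ℝ}

theorem radialFun_eventuallyEq {x : E2} (hx : x ≠ 0) (c : ℝ) :
    radialFun R c F =ᶠ[𝓝 x] fun y => F (logRadius R y) := by
  filter_upwards [isOpen_ne.mem_nhds hx] with y hy
  rw [radialFun, if_neg hy]

theorem radialFun_eventuallyEq_const (hR : 0 < R) (hN : ∀ t, N ≤ t → F t = F N) :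
    radialFun R (F N) F =ᶠ[𝓝 0] fun _ => F N := by
  have : Metric.ball (0 : E2) (R * rexp (-N / 2)) ∈ 𝓝 0 :=
    Metric.ball_mem_nhds _ (by positivity)
  filter_upwards [this] with y hy
  by_cases h : y = 0
  · rw [radialFun, if_pos h]
  · rw [radialFun, if_neg h]
    exact hN _ ((lt_logRadius_iff hR h N).2 (mem_ball_zero_iff.1 hy)).le

theorem hasFDerivAt_logRadius {x : E2} (hx : x ≠ 0) :
    HasFDerivAt (logRadius R) (-((‖x‖ ^ 2)⁻¹ • (2 : ℝ) • innerSL ℝ x)) x := by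
  have h1 : HasFDerivAt (fun y : E2 => ‖y‖ ^ 2) ((2 : ℝ) • innerSL ℝ x) x := by
    have := (hasStrictFDerivAt_norm_sq x).hasFDerivAt
    rwa [show (2 : ℕ) • innerSL ℝ x = (2 : ℝ) • innerSL ℝ x by rw [two_smul, two_smul]] at this
  have h2 : ‖x‖ ^ 2 ≠ 0 := by simpa using hx
  exact (h1.log h2).const_sub (Real.log (R ^ 2))

theorem contDiff_radialFun (hR : 0 < R) (hF : ContDiff ℝ (⊤ : ℕ∞) F)
    (hN : ∀ t, N ≤ t → F t = F N) : ContDiff ℝ (⊤ : ℕ∞) (radialFun R (F N) F) := by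
  rw [contDiff_iff_contDiffAt]
  intro x
  by_cases hx : x = 0
  · rw [hx]
    exact contDiffAt_const.congr_of_eventuallyEq (radialFun_eventuallyEq_const hR hN)
  · refine ContDiffAt.congr_of_eventuallyEq ?_ (radialFun_eventuallyEq hx _)
    refine hF.contDiffAt.comp x ?_
    unfold logRadius
    refine contDiffAt_const.sub ((contDiff_norm_sq ℝ).contDiffAt.log (by simpa using hx))

theorem isTestFun_radialFun (hR : 0 < R) (hF : ContDiff ℝ (⊤ : ℕ∞) F) (hδ : 0 < δ)
    (h0 : ∀ t, t ≤ δ → F t = 0) (hN : ∀ t, N ≤ t → F t = F N) :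
    IsTestFun (Metric.ball 0 R) (radialFun R (F N) F) := by
  have hsub : tsupport (radialFun R (F N) F) ⊆ Metric.closedBall 0 (R * rexp (-δ / 2)) := by
    refine closure_minimal (fun x hx => ?_) Metric.isClosed_closedBall
    by_contra h
    simp only [Metric.mem_closedBall, dist_zero_right, not_le] at h
    have hx0 : x ≠ 0 := by
      rintro rfl
      rw [norm_zero] at h
      have : 0 < R * rexp (-δ / 2) := by positivity
      linarith
    refine hx ?_
    rw [radialFun, if_neg hx0]
    refine h0 _ (not_lt.1 fun h' => ?_)
    rw [lt_logRadius_iff hR hx0] at h'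
    linarith
  refine ⟨contDiff_radialFun hR hF hN, (isCompact_closedBall _ _).of_isClosed_subset
    (isClosed_tsupport _) hsub, hsub.trans (Metric.closedBall_subset_ball ?_)⟩
  have : rexp (-δ / 2) < 1 := Real.exp_lt_one_iff.2 (by linarith)
  nlinarith

theorem norm_fderiv_radialFun_sq (hR : 0 < R) (hF : ContDiff ℝ (⊤ : ℕ∞) F) {x : E2} (hx : x ≠ 0)
    (c : ℝ) : ‖fderiv ℝ (radialFun R c F) x‖ ^ 2 =
      4 / R ^ 2 * (deriv F (logRadius R x) ^ 2 * rexp (logRadius R x)) := by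
  have hx' : 0 < ‖x‖ := norm_pos_iff.2 hx
  rw [(radialFun_eventuallyEq hx c).fderiv_eq]
  have h1 : HasDerivAt F (deriv F (logRadius R x)) (logRadius R x) :=
    ((hF.differentiable (by simp)) _).hasDerivAt
  have h2 := h1.comp_hasFDerivAt x (hasFDerivAt_logRadius (R := R) hx)
  have h3 : fderiv ℝ (fun y => F (logRadius R y)) x = _ := h2.fderiv
  rw [h3, exp_logRadius hR hx, norm_smul, norm_neg, norm_smul, norm_smul, innerSL_apply_norm,
    mul_pow, Real.norm_eq_abs, sq_abs]
  simp only [norm_inv, norm_pow, norm_norm, Real.norm_ofNat]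
  field_simp
  ring

theorem lambdaP_mul_sq_le_of_contDiff {Ω : Set E2} {A p : ℝ} (hp : 0 < p) (hA : 0 < A)
    (hΩ : (volume Ω).toReal = A) (hF : ContDiff ℝ (⊤ : ℕ∞) F) (hδ : 0 < δ)
    (h0 : ∀ t, t ≤ δ → F t = 0) (hN : ∀ t, N ≤ t → F t = F N) :
    lambdaP Ω p * (eLpNorm F (ENNReal.ofReal p) ((expMeas A).restrict (Ioi 0))).toReal ^ 2 ≤
      4 * π * ∫ t in Ioi 0, deriv F t ^ 2 := by
  set R := √(A / π) with hRdef
  have hR : 0 < R := Real.sqrt_pos.2 (by positivity)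
  have hAR : A = π * R ^ 2 := by
    rw [hRdef, Real.sq_sqrt (by positivity)]
    field_simp
  have hdisk : symDisk Ω = Metric.ball 0 R := by rw [symDisk, hΩ]
  have hV : IsTestFun (symDisk Ω) (radialFun R (F N) F) := by
    rw [hdisk]
    exact isTestFun_radialFun hR hF hδ h0 hN
  have hne : ∀ᵐ x ∂(volume.restrict (Metric.ball (0 : E2) R)), x ≠ 0 :=
    ae_restrict_of_ae (by simp [ae_iff])
  have hmain := lambdaP_mul_sq_le hp hV
  rw [hdisk] at hmain
  have hF' : Continuous (deriv F) := hF.continuous_deriv (by simp)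
  have e1 : eLpNorm (radialFun R (F N) F) (ENNReal.ofReal p)
      (volume.restrict (Metric.ball 0 R)) =
      eLpNorm F (ENNReal.ofReal p) ((expMeas A).restrict (Ioi 0)) := by
    rw [← map_logRadius hR hAR, eLpNorm_map_measure hF.continuous.aestronglyMeasurable
      (measurable_logRadius R).aemeasurable]
    refine eLpNorm_congr_ae ?_
    filter_upwards [hne] with x hx
    rw [radialFun, if_neg hx, Function.comp_apply]
  have e2 : ∫ x in Metric.ball (0 : E2) R, ‖fderiv ℝ (radialFun R (F N) F) x‖ ^ 2 =
      4 * π * ∫ t in Ioi 0, deriv F t ^ 2 := by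
    have s1 : ∫ x in Metric.ball (0 : E2) R, ‖fderiv ℝ (radialFun R (F N) F) x‖ ^ 2 =
        ∫ x in Metric.ball (0 : E2) R,
          4 / R ^ 2 * (deriv F (logRadius R x) ^ 2 * rexp (logRadius R x)) := by
      refine integral_congr_ae ?_
      filter_upwards [hne] with x hx
      exact norm_fderiv_radialFun_sq hR hF hx _
    have s2 := integral_map (μ := volume.restrict (Metric.ball (0 : E2) R))
      (measurable_logRadius R).aemeasurable
      (f := fun t => 4 / R ^ 2 * (deriv F t ^ 2 * rexp t))
      (by have : Continuous fun t => 4 / R ^ 2 * (deriv F t ^ 2 * rexp t) := by fun_prop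
          exact this.aestronglyMeasurable)
    rw [s1, ← s2, map_logRadius hR hAR, expMeas, restrict_withDensity measurableSet_Ioi,
      integral_withDensity_eq_integral_toReal_smul (by fun_prop)
        (Eventually.of_forall fun t => ENNReal.ofReal_lt_top), ← integral_const_mul]
    refine integral_congr_ae (Eventually.of_forall fun t => ?_)
    simp only [smul_eq_mul]
    rw [ENNReal.toReal_ofReal (by positivity), hAR, Real.exp_neg]
    field_simp
  rwa [e1, e2] at hmain

end radial

/-! ### The one-dimensional Sobolev inequality -/

theorem integral_sq_le_mul_integral_sq {f : ℝ → ℝ} {s t : ℝ} (hst : s ≤ t)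
    (hf : MemLp f 2 (volume.restrict (Ioc s t))) :
    (∫ x in s..t, f x) ^ 2 ≤ (t - s) * ∫ x in Ioc s t, f x ^ 2 := by
  rw [intervalIntegral.integral_of_le hst]
  have h2 : Integrable (fun x => f x ^ 2) (volume.restrict (Ioc s t)) := hf.integrable_sq
  have h1 : Integrable f (volume.restrict (Ioc s t)) := hf.integrable (by norm_num)
  set I := ∫ x in Ioc s t, f x with hI
  have h0 : 0 ≤ ∫ x in Ioc s t, ((t - s) * f x - I) ^ 2 := integral_nonneg fun x => sq_nonneg _
  have e : ∫ x in Ioc s t, ((t - s) * f x - I) ^ 2 =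
      (t - s) ^ 2 * (∫ x in Ioc s t, f x ^ 2) - 2 * (t - s) * I * I + I ^ 2 * (t - s) := by
    have : ∀ x, ((t - s) * f x - I) ^ 2 =
        (t - s) ^ 2 * f x ^ 2 - 2 * (t - s) * I * f x + I ^ 2 := fun x => by ring
    simp_rw [this]
    have h3 : Integrable (fun x => (t - s) ^ 2 * f x ^ 2 - 2 * (t - s) * I * f x)
        (volume.restrict (Ioc s t)) := (h2.const_mul _).sub (h1.const_mul _)
    rw [integral_add h3 (integrable_const _), integral_sub (h2.const_mul _) (h1.const_mul _),
      integral_const_mul, integral_const_mul, ← hI]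
    simp [hst]
    ring
  rw [e] at h0
  rcases hst.eq_or_lt with h | h
  · rw [← h] at hI
    simp [hI, h]
  · have : 0 < t - s := sub_pos.2 h
    nlinarith

theorem abs_intervalIntegral_le {f : ℝ → ℝ} (hf : MemLp f 2 (volume.restrict (Ioi 0))) {t : ℝ}
    (ht : 0 ≤ t) :
    |∫ x in (0 : ℝ)..t, f x| ≤ √t * (eLpNorm f 2 (volume.restrict (Ioi 0))).toReal := by
  have h1 := integral_sq_le_mul_integral_sq ht (hf.mono_measure
    (Measure.restrict_mono Ioc_subset_Ioi_self le_rfl))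
  have h2 : ∫ x in Ioc 0 t, f x ^ 2 ≤ ∫ x in Ioi 0, f x ^ 2 :=
    setIntegral_mono_set hf.integrable_sq (Eventually.of_forall fun x => sq_nonneg _)
      Ioc_subset_Ioi_self.eventuallyLE
  have h3 := integral_abs_rpow_eq (p := 2) (by norm_num) (by simpa using hf) 2
  simp only [ENNReal.ofReal_ofNat, Real.rpow_ofNat, sq_abs, div_self (two_ne_zero' ℝ),
    Real.rpow_one] at h3
  refine abs_le_of_sq_le_sq ?_ (by positivity)
  rw [mul_pow, Real.sq_sqrt ht, ← h3]
  rw [sub_zero] at h1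
  exact h1.trans (by gcongr)

theorem exists_contDiff_approx_Ioi {f : ℝ → ℝ} (hf : MemLp f 2 (volume.restrict (Ioi 0)))
    {ε : ℝ} (hε : 0 < ε) :
    ∃ g : ℝ → ℝ, ∃ δ > 0, ∃ N, ContDiff ℝ (⊤ : ℕ∞) g ∧ (∀ t, t ≤ δ → g t = 0) ∧
      (∀ t, N ≤ t → g t = 0) ∧
      eLpNorm (f - g) 2 (volume.restrict (Ioi 0)) ≤ ENNReal.ofReal ε := by
  obtain ⟨g, hgc, hgs, hfg⟩ := hf.exist_eLpNorm_sub_le (by simp) (by norm_num) (half_pos hε)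
  obtain ⟨B, hB⟩ := hgs.continuous.bounded_above_of_compact_support hgc
  have hB0 : 0 ≤ B := (norm_nonneg _).trans (hB 0)
  obtain ⟨N, hN⟩ := hgc.isCompact.bddAbove
  set δ : ℝ := (ε / 2) ^ 2 / (2 * (B ^ 2 + 1)) with hδ
  have hδpos : 0 < δ := by positivity
  set χ : ℝ → ℝ := fun t => Real.smoothTransition ((t - δ) / δ) with hχ
  have hχs : ContDiff ℝ (⊤ : ℕ∞) χ :=
    Real.smoothTransition.contDiff.comp (by fun_prop)
  have hχ0 : ∀ t, t ≤ δ → χ t = 0 := fun t ht =>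
    Real.smoothTransition.zero_of_nonpos (div_nonpos_of_nonpos_of_nonneg (by linarith) hδpos.le)
  have hχ1 : ∀ t, 2 * δ ≤ t → χ t = 1 := fun t ht =>
    Real.smoothTransition.one_of_one_le (by rw [le_div_iff₀ hδpos]; linarith)
  refine ⟨fun t => χ t * g t, δ, hδpos, N + 1, hχs.mul hgs, fun t ht => by simp [hχ0 t ht],
    fun t ht => ?_, ?_⟩
  · have : g t = 0 := by
      refine image_eq_zero_of_notMem_tsupport fun h => ?_
      have := hN h
      linarith
    simp [this]
  · have hsplit : f - (fun t => χ t * g t) = (f - g) + fun t => (1 - χ t) * g t := by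
      ext t
      simp only [Pi.sub_apply, Pi.add_apply]
      ring
    have hgm : AEStronglyMeasurable g (volume.restrict (Ioi 0)) :=
      hgs.continuous.aestronglyMeasurable
    have hkc : Continuous fun t => (1 - χ t) * g t :=
      (continuous_const.sub hχs.continuous).mul hgs.continuous
    rw [hsplit]
    refine (eLpNorm_add_le (hf.1.sub hgm) hkc.aestronglyMeasurable (by norm_num)).trans ?_
    have hsecond : eLpNorm (fun t => (1 - χ t) * g t) 2 (volume.restrict (Ioi 0)) ≤
        ENNReal.ofReal (ε / 2) := by
      have hpt : ∀ t ∈ Ioi (0 : ℝ), ‖(1 - χ t) * g t‖ₑ ≤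
          ‖(Ioc 0 (2 * δ)).indicator (fun _ => B) t‖ₑ := by
        intro t ht
        rw [enorm_le_iff_norm_le]
        by_cases h : t ≤ 2 * δ
        · rw [indicator_of_mem (by exact ⟨ht, h⟩), norm_mul, Real.norm_of_nonneg hB0]
          have h1 : ‖1 - χ t‖ ≤ 1 := by
            rw [Real.norm_eq_abs, abs_le]
            have a1 := Real.smoothTransition.nonneg ((t - δ) / δ)
            have a2 := Real.smoothTransition.le_one ((t - δ) / δ)
            constructor <;> simp only [hχ] <;> linarith
          have := hB t
          have := norm_nonneg (g t)
          nlinarith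
        · rw [hχ1 t (not_le.1 h).le]
          simp
      refine (eLpNorm_mono_enorm_ae ((ae_restrict_iff' measurableSet_Ioi).2
        (Eventually.of_forall hpt))).trans ?_
      rw [eLpNorm_indicator_const measurableSet_Ioc (by simp) (by simp),
        Measure.restrict_apply measurableSet_Ioc, inter_eq_left.2 Ioc_subset_Ioi_self,
        Real.volume_Ioc, sub_zero, Real.enorm_of_nonneg hB0,
        ENNReal.ofReal_rpow_of_nonneg (by positivity) (by simp),
        ← ENNReal.ofReal_mul hB0]
      refine ENNReal.ofReal_le_ofReal ?_
      have : (2 * δ) ^ (1 / (2 : ℝ≥0∞).toReal) = √(2 * δ) := by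
        rw [Real.sqrt_eq_rpow]
        simp
      rw [this]
      refine abs_le_of_sq_le_sq' ?_ (by positivity) |>.2
      rw [mul_pow, Real.sq_sqrt (by positivity), hδ]
      have : B ^ 2 * (2 * ((ε / 2) ^ 2 / (2 * (B ^ 2 + 1)))) =
          (ε / 2) ^ 2 * (B ^ 2 / (B ^ 2 + 1)) := by
        field_simp
      rw [this]
      refine mul_le_of_le_one_right (by positivity) ?_
      rw [div_le_one (by positivity)]
      linarith
    calc _ ≤ ENNReal.ofReal (ε / 2) + ENNReal.ofReal (ε / 2) := add_le_add hfg hsecond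
      _ = _ := by rw [← ENNReal.ofReal_add (by positivity) (by positivity), add_halves]

theorem memLp_rpow_expMeas (A : ℝ) {p a : ℝ} (hA : 0 ≤ A) (hp : 0 < p) (ha : 0 ≤ a) :
    MemLp (fun t : ℝ => t ^ a) (ENNReal.ofReal p) ((expMeas A).restrict (Ioi 0)) := by
  have hm : Measurable fun t : ℝ => t ^ a := by fun_prop
  rw [← integrable_norm_rpow_iff hm.aestronglyMeasurable (by simpa using hp) (by simp), expMeas,
    restrict_withDensity measurableSet_Ioi, integrable_withDensity_iff_integrable_smul'
      (by fun_prop) (Eventually.of_forall fun t => ENNReal.ofReal_lt_top)]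
  have h := (Real.GammaIntegral_convergent (s := a * p + 1) (by positivity)).const_mul A
  refine h.congr ?_
  refine (ae_restrict_iff' measurableSet_Ioi).2 (Eventually.of_forall fun t (ht : 0 < t) => ?_)
  simp only [smul_eq_mul]
  rw [ENNReal.toReal_ofReal (by positivity), ENNReal.toReal_ofReal hp.le,
    Real.norm_of_nonneg (by positivity), ← Real.rpow_mul ht.le, add_sub_cancel_right, mul_assoc]

section primitive

variable {f g : ℝ → ℝ}

theorem MeasureTheory.MemLp.intervalIntegrable_of_nonneg
    (hf : MemLp f 2 (volume.restrict (Ioi 0))) {s t : ℝ} (hs : 0 ≤ s) (ht : 0 ≤ t) :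
    IntervalIntegrable f volume s t := by
  have key : ∀ r : ℝ, 0 ≤ r → IntervalIntegrable f volume 0 r := fun r hr => by
    rw [intervalIntegrable_iff_integrableOn_Ioc_of_le hr]
    exact (hf.mono_measure (Measure.restrict_mono Ioc_subset_Ioi_self le_rfl)).integrable
      (by norm_num)
  exact (key s hs).symm.trans (key t ht)

theorem continuousOn_primitive_Ioi (hf : MemLp f 2 (volume.restrict (Ioi 0))) :
    ContinuousOn (fun t => ∫ x in (0 : ℝ)..t, f x) (Ioi 0) := by
  intro t ht
  have ht0 : (0 : ℝ) < t := ht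
  have h1 := intervalIntegral.continuousOn_primitive_interval' (b₁ := 0) (b₂ := t + 1) (a := 0)
    (hf.intervalIntegrable_of_nonneg le_rfl (by linarith)) left_mem_uIcc
  refine (h1.continuousAt ?_).continuousWithinAt
  rw [uIcc_of_le (by linarith)]
  exact Icc_mem_nhds ht0 (by linarith)

variable {A p : ℝ}

theorem aestronglyMeasurable_primitive (hf : MemLp f 2 (volume.restrict (Ioi 0)))
    (ν : Measure ℝ) :
    AEStronglyMeasurable (fun t => ∫ x in (0 : ℝ)..t, f x) (ν.restrict (Ioi 0)) :=
  (continuousOn_primitive_Ioi hf).aestronglyMeasurable measurableSet_Ioi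

theorem abs_primitive_le (hf : MemLp f 2 (volume.restrict (Ioi 0))) :
    ∀ᵐ t ∂((expMeas A).restrict (Ioi 0)), ‖∫ x in (0 : ℝ)..t, f x‖ ≤
      (eLpNorm f 2 (volume.restrict (Ioi 0))).toReal * ‖t ^ (1 / 2 : ℝ)‖ := by
  refine (ae_restrict_iff' measurableSet_Ioi).2 (Eventually.of_forall fun t (ht : 0 < t) => ?_)
  rw [Real.norm_eq_abs, Real.norm_of_nonneg (by positivity), ← Real.sqrt_eq_rpow, mul_comm]
  exact abs_intervalIntegral_le hf ht.le

theorem memLp_primitive (hA : 0 ≤ A) (hp : 0 < p) (hf : MemLp f 2 (volume.restrict (Ioi 0))) :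
    MemLp (fun t => ∫ x in (0 : ℝ)..t, f x) (ENNReal.ofReal p) ((expMeas A).restrict (Ioi 0)) :=
  (memLp_rpow_expMeas A hA hp (by norm_num)).of_le_mul (aestronglyMeasurable_primitive hf _)
    (abs_primitive_le hf)

theorem toReal_eLpNorm_primitive_le (hA : 0 ≤ A) (hp : 0 < p)
    (hf : MemLp f 2 (volume.restrict (Ioi 0))) :
    (eLpNorm (fun t => ∫ x in (0 : ℝ)..t, f x) (ENNReal.ofReal p)
        ((expMeas A).restrict (Ioi 0))).toReal ≤
      (eLpNorm f 2 (volume.restrict (Ioi 0))).toReal *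
        (eLpNorm (fun t : ℝ => t ^ (1 / 2 : ℝ)) (ENNReal.ofReal p)
          ((expMeas A).restrict (Ioi 0))).toReal := by
  have h := eLpNorm_le_mul_eLpNorm_of_ae_le_mul (abs_primitive_le (A := A) hf) (ENNReal.ofReal p)
  have h' := ENNReal.toReal_mono (ENNReal.mul_ne_top (by simp)
    (memLp_rpow_expMeas A hA hp (by norm_num)).2.ne) h
  rwa [ENNReal.toReal_mul, ENNReal.toReal_ofReal ENNReal.toReal_nonneg] at h'

theorem toReal_eLpNorm_two_sq {ν : Measure ℝ} (hf : MemLp f 2 ν) :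
    (eLpNorm f 2 ν).toReal ^ 2 = ∫ t, f t ^ 2 ∂ν := by
  have h3 := integral_abs_rpow_eq (p := 2) (by norm_num) (by simpa using hf) 2
  simpa using h3.symm

theorem contDiff_primitive (hg : ContDiff ℝ (⊤ : ℕ∞) g) :
    ContDiff ℝ (⊤ : ℕ∞) (fun t => ∫ x in (0 : ℝ)..t, g x) ∧
      deriv (fun t => ∫ x in (0 : ℝ)..t, g x) = g := by
  have hd : deriv (fun t => ∫ x in (0 : ℝ)..t, g x) = g :=
    funext fun t => hg.continuous.deriv_integral g 0 t
  refine ⟨contDiff_infty_iff_deriv.2 ⟨fun t => ?_, hd.symm ▸ hg⟩, hd⟩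
  exact (intervalIntegral.integral_hasDerivAt_right (hg.continuous.intervalIntegrable 0 t)
    hg.continuous.stronglyMeasurable.stronglyMeasurableAtFilter
    hg.continuous.continuousAt).differentiableAt

theorem lambdaP_mul_sq_le_of_memLp {Ω : Set E2} (hp : 1 ≤ p) (hA : 0 < A)
    (hΩ : (volume Ω).toReal = A) (hf : MemLp f 2 (volume.restrict (Ioi 0))) :
    lambdaP Ω p * (eLpNorm (fun t => ∫ x in (0 : ℝ)..t, f x) (ENNReal.ofReal p)
      ((expMeas A).restrict (Ioi 0))).toReal ^ 2 ≤ 4 * π * ∫ t in Ioi 0, f t ^ 2 := by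
  have hp0 : 0 < p := by linarith
  set F : ℝ → ℝ := fun t => ∫ x in (0 : ℝ)..t, f x with hFdef
  set μ := (expMeas A).restrict (Ioi 0)
  set K := (eLpNorm (fun t : ℝ => t ^ (1 / 2 : ℝ)) (ENNReal.ofReal p) μ).toReal with hK
  have hK0 : 0 ≤ K := ENNReal.toReal_nonneg
  have hL := lambdaP_nonneg Ω p
  set NF := (eLpNorm F (ENNReal.ofReal p) μ).toReal with hNF
  have hNF0 : 0 ≤ NF := ENNReal.toReal_nonneg
  set nf := (eLpNorm f 2 (volume.restrict (Ioi 0))).toReal with hnf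
  have hnf0 : 0 ≤ nf := ENNReal.toReal_nonneg
  rw [← toReal_eLpNorm_two_sq hf, ← hnf]
  suffices h : √(lambdaP Ω p) * NF ≤ √(4 * π) * nf by
    have h2 := pow_le_pow_left₀ (by positivity) h 2
    rwa [mul_pow, mul_pow, Real.sq_sqrt hL, Real.sq_sqrt (by positivity)] at h2
  have key : ∀ ε > 0, √(lambdaP Ω p) * NF ≤ √(4 * π) * nf +
      ε * (√(4 * π) + √(lambdaP Ω p) * K) := by
    intro ε hε
    obtain ⟨g, δ, hδ, N, hg, hg0, hgN, hfg⟩ := exists_contDiff_approx_Ioi hf hε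
    obtain ⟨hG, hG'⟩ := contDiff_primitive hg
    set G : ℝ → ℝ := fun t => ∫ x in (0 : ℝ)..t, g x with hGdef
    have hG0 : ∀ t, t ≤ δ → G t = 0 := fun t ht => by
      refine (intervalIntegral.integral_congr (g := fun _ => (0 : ℝ)) fun x hx => hg0 x ?_).trans
        (by simp)
      rw [uIcc, mem_Icc] at hx
      exact hx.2.trans (max_le hδ.le ht)
    have hGN : ∀ t, N ≤ t → G t = G N := fun t ht => by
      rw [← sub_eq_zero, hGdef]
      simp only
      rw [intervalIntegral.integral_interval_sub_left (hg.continuous.intervalIntegrable _ _)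
        (hg.continuous.intervalIntegrable _ _)]
      refine (intervalIntegral.integral_congr (g := fun _ => (0 : ℝ)) fun x hx => hgN x ?_).trans
        (by simp)
      rw [uIcc_of_le ht, mem_Icc] at hx
      exact hx.1
    have hfgt : eLpNorm (f - g) 2 (volume.restrict (Ioi 0)) ≠ ∞ := ne_top_of_le_ne_top (by simp) hfg
    have hfgm : MemLp (f - g) 2 (volume.restrict (Ioi 0)) :=
      ⟨hf.1.sub hg.continuous.aestronglyMeasurable, hfgt.lt_top⟩
    have hgm : MemLp g 2 (volume.restrict (Ioi 0)) := by
      have := hf.sub hfgm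
      rwa [sub_sub_cancel] at this
    have hfg' : (eLpNorm (f - g) 2 (volume.restrict (Ioi 0))).toReal ≤ ε :=
      ENNReal.toReal_le_of_le_ofReal hε.le hfg
    have hsob := lambdaP_mul_sq_le_of_contDiff (Ω := Ω) hp0 hA hΩ hG hδ hG0 hGN
    rw [hG', ← toReal_eLpNorm_two_sq hgm] at hsob
    have hsob' : √(lambdaP Ω p) * (eLpNorm G (ENNReal.ofReal p) μ).toReal ≤
        √(4 * π) * (eLpNorm g 2 (volume.restrict (Ioi 0))).toReal := by
      refine abs_le_of_sq_le_sq' ?_ (by positivity) |>.2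
      rwa [mul_pow, mul_pow, Real.sq_sqrt hL, Real.sq_sqrt (by positivity)]
    have hgf : (eLpNorm g 2 (volume.restrict (Ioi 0))).toReal ≤ nf + ε := by
      have h := eLpNorm_sub_le hf.1 hfgm.1 (p := 2) (by norm_num)
      rw [sub_sub_cancel] at h
      refine (ENNReal.toReal_mono (ENNReal.add_ne_top.2 ⟨hf.2.ne, hfgt⟩) h).trans ?_
      rw [ENNReal.toReal_add hf.2.ne hfgt]
      gcongr
    have hFG : NF ≤ (eLpNorm G (ENNReal.ofReal p) μ).toReal + ε * K := by
      have hd : (fun t => ∫ x in (0 : ℝ)..t, (f - g) x) =ᵐ[μ] F - G := by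
        refine (ae_restrict_iff' measurableSet_Ioi).2
          (Eventually.of_forall fun t (ht : 0 < t) => ?_)
        exact intervalIntegral.integral_sub (hf.intervalIntegrable_of_nonneg le_rfl ht.le)
          (hg.continuous.intervalIntegrable _ _)
      have h1 := toReal_eLpNorm_primitive_le (A := A) hA.le hp0 hfgm
      rw [eLpNorm_congr_ae hd] at h1
      have hGm := memLp_primitive (A := A) hA.le hp0 hgm
      have hFm := memLp_primitive (A := A) hA.le hp0 hf
      have h2 := eLpNorm_add_le hGm.1 (hFm.1.sub hGm.1) (p := ENNReal.ofReal p)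
        (by simpa using hp)
      have e : G + (F - G) = F := by abel
      have h3 := ENNReal.toReal_mono (ENNReal.add_ne_top.2 ⟨hGm.2.ne, (hFm.sub hGm).2.ne⟩) h2
      rw [ENNReal.toReal_add hGm.2.ne (hFm.sub hGm).2.ne] at h3
      change (eLpNorm (G + (F - G)) (ENNReal.ofReal p) μ).toReal ≤ _ at h3
      rw [e] at h3
      refine h3.trans (add_le_add le_rfl (h1.trans ?_))
      gcongr
    have hs0 : 0 ≤ √(lambdaP Ω p) := Real.sqrt_nonneg _
    calc √(lambdaP Ω p) * NF ≤
          √(lambdaP Ω p) * ((eLpNorm G (ENNReal.ofReal p) μ).toReal + ε * K) := by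
          gcongr
      _ = √(lambdaP Ω p) * (eLpNorm G (ENNReal.ofReal p) μ).toReal + ε * (√(lambdaP Ω p) * K) := by
          ring
      _ ≤ √(4 * π) * (nf + ε) + ε * (√(lambdaP Ω p) * K) := by
          exact add_le_add (hsob'.trans (mul_le_mul_of_nonneg_left hgf (Real.sqrt_nonneg _))) le_rfl
      _ = _ := by ring
  refine le_of_forall_pos_le_add fun η hη => ?_
  set B := √(4 * π) + √(lambdaP Ω p) * K with hB
  have hB0 : 0 < B := by positivity
  have := key (η / B) (by positivity)
  rwa [div_mul_cancel₀ _ hB0.ne'] at this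

end primitive

/-! ### The one-dimensional Moser-type inequality -/

theorem lintegral_exp_neg_le_tsum {D : ℝ → ℝ} {B : ℝ}
    (hD : AEMeasurable D (volume.restrict (Ioi 0))) (hD0 : ∀ t, 0 < t → 0 ≤ D t)
    (hB : ∀ n : ℕ, volume ({t | D t ≤ n + 1} ∩ Ioi 0) ≤ ENNReal.ofReal (B * (n + 1))) :
    ∫⁻ t in Ioi 0, ENNReal.ofReal (rexp (-D t)) ≤
      ∑' n : ℕ, ENNReal.ofReal (rexp (-n)) * ENNReal.ofReal (B * (n + 1)) := by
  set φ : ℕ → ℝ → ℝ≥0∞ := fun n t =>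
    {t | D t ≤ n + 1}.indicator (fun _ => ENNReal.ofReal (rexp (-n))) t with hφ
  have hφm : ∀ n, AEMeasurable (φ n) (volume.restrict (Ioi 0)) := fun n => by
    have h1 : Measurable ((Iic ((n : ℝ) + 1)).indicator fun _ => ENNReal.ofReal (rexp (-n))) :=
      measurable_const.indicator measurableSet_Iic
    exact h1.comp_aemeasurable hD
  calc ∫⁻ t in Ioi 0, ENNReal.ofReal (rexp (-D t)) ≤ ∫⁻ t in Ioi 0, ∑' n, φ n t := by
        refine lintegral_mono_ae ((ae_restrict_iff' measurableSet_Ioi).2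
          (Eventually.of_forall fun t (ht : 0 < t) => ?_))
        refine le_trans ?_ (ENNReal.le_tsum ⌊D t⌋₊)
        rw [hφ]
        simp only
        rw [indicator_of_mem (by exact (Nat.lt_floor_add_one (D t)).le)]
        exact ENNReal.ofReal_le_ofReal (Real.exp_le_exp.2
          (neg_le_neg (Nat.floor_le (hD0 t ht))))
    _ = ∑' n, ∫⁻ t in Ioi 0, φ n t := lintegral_tsum hφm
    _ ≤ _ := by
        refine ENNReal.tsum_le_tsum fun n => (lintegral_indicator_const_le _ _).trans ?_
        rw [Measure.restrict_apply' measurableSet_Ioi]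
        gcongr
        exact hB n

theorem tsum_ofReal_exp_neg_mul_ne_top (B : ℝ) :
    ∑' n : ℕ, ENNReal.ofReal (rexp (-n)) * ENNReal.ofReal (B * (n + 1)) ≠ ∞ := by
  have h1 := Real.summable_pow_mul_exp_neg_nat_mul 1 one_pos
  have h0 := Real.summable_pow_mul_exp_neg_nat_mul 0 one_pos
  have hs : Summable fun n : ℕ => rexp (-n) * (B * (n + 1)) := by
    refine ((h1.add h0).mul_left B).congr fun n => ?_
    simp only [pow_one, pow_zero, neg_one_mul, one_mul]
    ring
  have e : ∀ n : ℕ, ENNReal.ofReal (rexp (-n)) * ENNReal.ofReal (B * (n + 1)) =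
      ENNReal.ofReal (rexp (-n) * (B * (n + 1))) := fun n =>
    (ENNReal.ofReal_mul (Real.exp_nonneg _)).symm
  simp_rw [e]
  exact hs.tsum_ofReal_ne_top

section moser

variable {f : ℝ → ℝ}

/-- If `F(t) = ∫₀ᵗ f` satisfies `F(T)² + T ∫_T^∞ f² ≤ T + C` for all `T`, then the set where
`F²` is within `k` of the maximal possible value `t + C` has measure `O(k)`. -/
theorem volume_near_extremal_le {C k : ℝ} (hC : 0 ≤ C) (hk : 1 ≤ k)
    (hf : MemLp f 2 (volume.restrict (Ioi 0)))
    (hF : ∀ T, 0 < T → (∫ x in (0 : ℝ)..T, f x) ^ 2 + T * ∫ x in Ioi T, f x ^ 2 ≤ T + C) :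
    volume ({t | t + C - (∫ x in (0 : ℝ)..t, f x) ^ 2 ≤ k} ∩ Ioi 0) ≤
      ENNReal.ofReal ((22 + C) * k) := by
  set F : ℝ → ℝ := fun t => ∫ x in (0 : ℝ)..t, f x with hFdef
  set S := {t | t + C - F t ^ 2 ≤ k} ∩ Ioi 0 with hS
  have key : ∀ T ∈ S ∩ Ioi (4 * k + C), ∀ t ∈ S ∩ Ioi (4 * k + C), T ≤ t → t - T ≤ 18 * k := by
    rintro T ⟨⟨hT1, hT0⟩, hT2⟩ t ⟨⟨ht1, ht0⟩, ht2⟩ hTt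
    simp only [mem_ofPred_eq, mem_Ioi] at hT1 hT0 hT2 ht1 ht0 ht2
    have hb := hF T hT0
    change F T ^ 2 + _ ≤ _ at hb
    have hI0 : 0 ≤ ∫ x in Ioi T, f x ^ 2 := integral_nonneg fun x => sq_nonneg _
    set d := ∫ x in T..t, f x with hd
    have hFd : F t = F T + d := (intervalIntegral.integral_add_adjacent_intervals
      (hf.intervalIntegrable_of_nonneg le_rfl hT0.le)
      (hf.intervalIntegrable_of_nonneg hT0.le ht0.le)).symm
    have hd2 : d ^ 2 ≤ (t - T) * ∫ x in Ioi T, f x ^ 2 := by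
      have hm : MemLp f 2 (volume.restrict (Ioi T)) :=
        hf.mono_measure (Measure.restrict_mono (Ioi_subset_Ioi hT0.le) le_rfl)
      refine (integral_sq_le_mul_integral_sq hTt (hm.mono_measure
        (Measure.restrict_mono Ioc_subset_Ioi_self le_rfl))).trans ?_
      refine mul_le_mul_of_nonneg_left ?_ (by linarith)
      exact setIntegral_mono_set hm.integrable_sq (Eventually.of_forall fun x => sq_nonneg _)
        Ioc_subset_Ioi_self.eventuallyLE
    have hTI : T * ∫ x in Ioi T, f x ^ 2 ≤ k := by linarith
    have hTd : T * d ^ 2 ≤ (t - T) * k := by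
      calc T * d ^ 2 ≤ T * ((t - T) * ∫ x in Ioi T, f x ^ 2) := by gcongr
        _ = (t - T) * (T * ∫ x in Ioi T, f x ^ 2) := by ring
        _ ≤ _ := by gcongr
    have hd3 : d ^ 2 ≤ (t - T) / 4 := by
      have : T * d ^ 2 ≤ T * ((t - T) / 4) := hTd.trans (by nlinarith)
      exact le_of_mul_le_mul_left this hT0
    have hFT : F T ^ 2 ≤ 2 * T := by
      have : 0 ≤ T * ∫ x in Ioi T, f x ^ 2 := by positivity
      linarith
    have hcross : 2 * F T * d ≤ (t - T) / 4 + 8 * k := by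
      have h1 : 0 ≤ (4 * k * F T - T * d) ^ 2 := sq_nonneg _
      have h2 : T * (2 * F T * d) * (4 * k) ≤ T * ((t - T) / 4 + 8 * k) * (4 * k) := by
        have a1 : (4 * k) ^ 2 * F T ^ 2 ≤ (4 * k) ^ 2 * (2 * T) := by gcongr
        have a2 : T * (T * d ^ 2) ≤ T * ((t - T) * k) := by gcongr
        nlinarith
      have h3 := le_of_mul_le_mul_right h2 (by linarith)
      exact le_of_mul_le_mul_left h3 hT0
    rw [hFd] at ht1
    nlinarith
  have hsub : S ⊆ Ioc 0 (4 * k + C) ∪ (S ∩ Ioi (4 * k + C)) := by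
    intro t ht
    by_cases h : t ≤ 4 * k + C
    · exact Or.inl ⟨ht.2, h⟩
    · exact Or.inr ⟨ht, not_le.1 h⟩
  have hv2 : volume (S ∩ Ioi (4 * k + C)) ≤ ENNReal.ofReal (18 * k) := by
    refine (Real.volume_le_diam _).trans (Metric.ediam_le fun x hx y hy => ?_)
    rw [edist_dist, Real.dist_eq]
    refine ENNReal.ofReal_le_ofReal ?_
    rcases le_total x y with h | h
    · rw [abs_sub_comm, abs_of_nonneg (by linarith)]
      exact key x hx y hy h
    · rw [abs_of_nonneg (by linarith)]
      exact key y hy x hx h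
  calc volume S ≤ volume (Ioc 0 (4 * k + C)) + volume (S ∩ Ioi (4 * k + C)) :=
        (measure_mono hsub).trans (measure_union_le _ _)
    _ ≤ ENNReal.ofReal (4 * k + C) + ENNReal.ofReal (18 * k) := by
        gcongr
        simp
    _ = ENNReal.ofReal (4 * k + C + 18 * k) :=
        (ENNReal.ofReal_add (by linarith) (by linarith)).symm
    _ ≤ _ := ENNReal.ofReal_le_ofReal (by nlinarith)

variable {A p κ κp : ℝ}

theorem exists_primitive_sq_add_le (hA : 0 ≤ A) (hp : 1 ≤ p) (hκ : 0 ≤ κ) (hκp : κ < κp)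
    (hS : ∀ f : ℝ → ℝ, MemLp f 2 (volume.restrict (Ioi 0)) →
      κp * (eLpNorm (fun t => ∫ x in (0 : ℝ)..t, f x) (ENNReal.ofReal p)
        ((expMeas A).restrict (Ioi 0))).toReal ^ 2 ≤ ∫ t in Ioi 0, f t ^ 2) :
    ∃ C, 0 ≤ C ∧ ∀ f : ℝ → ℝ, MemLp f 2 (volume.restrict (Ioi 0)) →
      ∫ t in Ioi 0, f t ^ 2 ≤ 1 + κ * (eLpNorm (fun t => ∫ x in (0 : ℝ)..t, f x)
        (ENNReal.ofReal p) ((expMeas A).restrict (Ioi 0))).toReal ^ 2 →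
      ∀ T, 0 < T → (∫ x in (0 : ℝ)..T, f x) ^ 2 + T * ∫ x in Ioi T, f x ^ 2 ≤ T + C := by
  have hp0 : 0 < p := by linarith
  set μ := (expMeas A).restrict (Ioi 0) with hμ
  set K := (eLpNorm (fun t : ℝ => t ^ (1 : ℝ)) (ENNReal.ofReal p) μ).toReal with hK
  have hκ' : 0 < κp - κ := sub_pos.2 hκp
  set E := κp / (κp - κ) with hE
  have hE0 : 0 ≤ E := div_nonneg (by linarith) hκ'.le
  refine ⟨κ * E * (E * K ^ 2), by positivity, fun f hf hf1 T hT => ?_⟩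
  set F : ℝ → ℝ := fun t => ∫ x in (0 : ℝ)..t, f x with hF
  set N := (eLpNorm F (ENNReal.ofReal p) μ).toReal with hN
  have hfE : ∫ t in Ioi 0, f t ^ 2 ≤ E := by
    have h := (hS f hf).trans hf1
    change κp * N ^ 2 ≤ 1 + κ * N ^ 2 at h
    have h2 : N ^ 2 ≤ 1 / (κp - κ) := by
      rw [le_div_iff₀ hκ']
      linarith
    calc _ ≤ 1 + κ * N ^ 2 := hf1
      _ ≤ 1 + κ * (1 / (κp - κ)) := by gcongr
      _ = E := by
        rw [hE]
        field_simp
        ring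
  have hFE : ∀ t, 0 < t → |F t| ≤ √E * √t := fun t ht => by
    refine (abs_intervalIntegral_le hf ht.le).trans ?_
    rw [mul_comm]
    refine mul_le_mul_of_nonneg_right (Real.le_sqrt_of_sq_le ?_) (Real.sqrt_nonneg _)
    rwa [toReal_eLpNorm_two_sq hf]
  set a := F T with ha
  set z : ℝ → ℝ := (Ioc 0 T).indicator fun x => f x - a / T with hz
  have hfT : MemLp f 2 (volume.restrict (Ioc 0 T)) :=
    hf.mono_measure (Measure.restrict_mono Ioc_subset_Ioi_self le_rfl)
  have hfT1 : Integrable f (volume.restrict (Ioc 0 T)) := hfT.integrable (by norm_num)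
  have hzm : MemLp z 2 (volume.restrict (Ioi 0)) := by
    rw [hz, memLp_indicator_iff_restrict measurableSet_Ioc,
      Measure.restrict_restrict measurableSet_Ioc, inter_eq_left.2 Ioc_subset_Ioi_self]
    exact hfT.sub (memLp_const _)
  set Z : ℝ → ℝ := fun t => ∫ x in (0 : ℝ)..t, z x with hZ
  have hFT : ∫ x in Ioc 0 T, f x = a := by
    rw [ha, hF]
    simp only
    rw [intervalIntegral.integral_of_le hT.le]
  have hZle : ∀ t, 0 < t → t ≤ T → Z t = F t - a / T * t := by
    intro t ht htT
    have h1 : Z t = ∫ x in (0 : ℝ)..t, (f x - a / T) := by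
      rw [hZ]
      simp only
      rw [intervalIntegral.integral_of_le ht.le, intervalIntegral.integral_of_le ht.le]
      refine setIntegral_congr_fun measurableSet_Ioc fun x hx => ?_
      exact indicator_of_mem (show x ∈ Ioc 0 T from ⟨hx.1, hx.2.trans htT⟩) _
    rw [h1, intervalIntegral.integral_sub (hf.intervalIntegrable_of_nonneg le_rfl ht.le)
      (by simp), intervalIntegral.integral_const]
    simp [hF]
    ring
  have hZge : ∀ t, T ≤ t → Z t = 0 := by
    intro t ht
    have ht0 := hT.trans_le ht
    have h1 : Z t = ∫ x in Ioc 0 T, (f x - a / T) := by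
      rw [hZ]
      simp only
      rw [intervalIntegral.integral_of_le ht0.le, hz, setIntegral_indicator measurableSet_Ioc,
        inter_eq_right.2 (Ioc_subset_Ioc_right ht)]
    rw [h1, integral_sub hfT1 (integrable_const _), hFT]
    simp only [integral_const, measureReal_restrict_apply_univ, volume_real_Ioc_of_le hT.le,
      sub_zero, smul_eq_mul]
    field_simp
    ring
  have hzint : ∫ t in Ioi 0, z t ^ 2 = (∫ t in Ioc 0 T, f t ^ 2) - a ^ 2 / T := by
    have h1 : ∀ t, z t ^ 2 = (Ioc 0 T).indicator
        (fun x => f x ^ 2 - 2 * (a / T) * f x + (a / T) ^ 2) t := by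
      intro t
      by_cases h : t ∈ Ioc 0 T
      · rw [hz, indicator_of_mem h, indicator_of_mem h]
        ring
      · rw [hz, indicator_of_notMem h, indicator_of_notMem h]
        simp
    simp_rw [h1]
    have h3 : Integrable (fun x => f x ^ 2 - 2 * (a / T) * f x) (volume.restrict (Ioc 0 T)) :=
      hfT.integrable_sq.sub (hfT1.const_mul _)
    rw [setIntegral_indicator measurableSet_Ioc, inter_eq_right.2 Ioc_subset_Ioi_self,
      integral_add h3 (integrable_const _), integral_sub hfT.integrable_sq (hfT1.const_mul _),
      integral_const_mul, hFT]
    simp [hT.le]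
    field_simp
    ring
  have hsplit : ∫ t in Ioi 0, f t ^ 2 =
      (∫ t in Ioc 0 T, f t ^ 2) + ∫ t in Ioi T, f t ^ 2 := by
    rw [← Ioc_union_Ioi_eq_Ioi hT.le, setIntegral_union (Ioc_disjoint_Ioi le_rfl)
      measurableSet_Ioi hfT.integrable_sq
      (hf.mono_measure (Measure.restrict_mono (Ioi_subset_Ioi hT.le) le_rfl)).integrable_sq]
  have hFm := memLp_primitive (A := A) hA hp0 hf
  have hZm := memLp_primitive (A := A) hA hp0 hzm
  set ℓ := F - Z with hℓ
  have hℓb : ∀ᵐ t ∂μ, ‖ℓ t‖ ≤ √E / √T * ‖t ^ (1 : ℝ)‖ := by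
    refine (ae_restrict_iff' measurableSet_Ioi).2 (Eventually.of_forall fun t (ht : 0 < t) => ?_)
    have hsT : 0 < √T := Real.sqrt_pos.2 hT
    have hTT : √T * √T = T := Real.mul_self_sqrt hT.le
    rw [Real.rpow_one, Real.norm_of_nonneg ht.le, Real.norm_eq_abs, hℓ, Pi.sub_apply]
    rcases le_total t T with h | h
    · rw [hZle t ht h, sub_sub_cancel, abs_mul, abs_of_pos ht, abs_div, abs_of_pos hT]
      refine mul_le_mul_of_nonneg_right ?_ ht.le
      rw [div_le_div_iff₀ hT hsT]
      calc |a| * √T ≤ √E * √T * √T := mul_le_mul_of_nonneg_right (hFE T hT) hsT.le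
        _ = √E * T := by rw [mul_assoc, hTT]
    · rw [hZge t h, sub_zero]
      refine (hFE t ht).trans ?_
      rw [div_mul_eq_mul_div, mul_div_assoc]
      refine mul_le_mul_of_nonneg_left ?_ (Real.sqrt_nonneg _)
      rw [le_div_iff₀ hsT]
      calc √t * √T ≤ √t * √t := by gcongr
        _ = t := Real.mul_self_sqrt ht.le
  set Nℓ := (eLpNorm ℓ (ENNReal.ofReal p) μ).toReal with hNℓ
  set NZ := (eLpNorm Z (ENNReal.ofReal p) μ).toReal with hNZ
  have hNℓK : Nℓ ≤ √E / √T * K := by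
    have h := eLpNorm_le_mul_eLpNorm_of_ae_le_mul hℓb (ENNReal.ofReal p)
    have h' := ENNReal.toReal_mono (ENNReal.mul_ne_top (by simp)
      (memLp_rpow_expMeas A hA hp0 (by norm_num)).2.ne) h
    rwa [ENNReal.toReal_mul, ENNReal.toReal_ofReal (by positivity)] at h'
  have hNℓ2 : Nℓ ^ 2 ≤ E * K ^ 2 / T := by
    have h0 : 0 ≤ Nℓ := ENNReal.toReal_nonneg
    calc Nℓ ^ 2 ≤ (√E / √T * K) ^ 2 := by gcongr
      _ = _ := by
        rw [mul_pow, div_pow, Real.sq_sqrt hE0, Real.sq_sqrt hT.le]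
        ring
  have hNtri : N ≤ NZ + Nℓ := by
    have h2 := eLpNorm_add_le hZm.1 (hFm.1.sub hZm.1) (p := ENNReal.ofReal p) (by simpa using hp)
    have h3 := ENNReal.toReal_mono (ENNReal.add_ne_top.2 ⟨hZm.2.ne, (hFm.sub hZm).2.ne⟩) h2
    rw [ENNReal.toReal_add hZm.2.ne (hFm.sub hZm).2.ne] at h3
    have e : Z + (F - Z) = F := by abel
    change (eLpNorm (Z + (F - Z)) (ENNReal.ofReal p) μ).toReal ≤ _ at h3
    rwa [e] at h3
  have hZS := hS z hzm
  change κp * NZ ^ 2 ≤ _ at hZS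
  have hN2 : κ * N ^ 2 ≤ κp * NZ ^ 2 + κ * E * Nℓ ^ 2 := by
    have h0 : 0 ≤ N := ENNReal.toReal_nonneg
    have e : κp * NZ ^ 2 + κ * E * Nℓ ^ 2 - κ * (NZ + Nℓ) ^ 2 =
        ((κp - κ) * NZ - κ * Nℓ) ^ 2 / (κp - κ) := by
      rw [hE]
      field_simp
      ring
    have h1 : 0 ≤ ((κp - κ) * NZ - κ * Nℓ) ^ 2 / (κp - κ) := by positivity
    have h2 : κ * N ^ 2 ≤ κ * (NZ + Nℓ) ^ 2 := by gcongr
    linarith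
  have hfin : a ^ 2 / T + ∫ t in Ioi T, f t ^ 2 ≤ 1 + κ * E * (E * K ^ 2 / T) := by
    have h2 : κ * E * Nℓ ^ 2 ≤ κ * E * (E * K ^ 2 / T) := by gcongr
    rw [hsplit] at hf1
    change _ ≤ 1 + κ * N ^ 2 at hf1
    linarith
  have h := mul_le_mul_of_nonneg_left hfin hT.le
  have e1 : T * (a ^ 2 / T + ∫ t in Ioi T, f t ^ 2) = a ^ 2 + T * ∫ t in Ioi T, f t ^ 2 := by
    field_simp
  have e2 : T * (1 + κ * E * (E * K ^ 2 / T)) = T + κ * E * (E * K ^ 2) := by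
    field_simp
  rwa [e1, e2] at h

theorem exists_lintegral_exp_sq_sub_le (hA : 0 ≤ A) (hp : 1 ≤ p) (hκ : 0 ≤ κ) (hκp : κ < κp)
    (hS : ∀ f : ℝ → ℝ, MemLp f 2 (volume.restrict (Ioi 0)) →
      κp * (eLpNorm (fun t => ∫ x in (0 : ℝ)..t, f x) (ENNReal.ofReal p)
        ((expMeas A).restrict (Ioi 0))).toReal ^ 2 ≤ ∫ t in Ioi 0, f t ^ 2) :
    ∃ C : ℝ≥0∞, C ≠ ∞ ∧ ∀ f : ℝ → ℝ, MemLp f 2 (volume.restrict (Ioi 0)) →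
      ∫ t in Ioi 0, f t ^ 2 ≤ 1 + κ * (eLpNorm (fun t => ∫ x in (0 : ℝ)..t, f x)
        (ENNReal.ofReal p) ((expMeas A).restrict (Ioi 0))).toReal ^ 2 →
      ∫⁻ t in Ioi 0, ENNReal.ofReal (rexp ((∫ x in (0 : ℝ)..t, f x) ^ 2 - t)) ≤ C := by
  obtain ⟨C, hC, H⟩ := exists_primitive_sq_add_le hA hp hκ hκp hS
  refine ⟨ENNReal.ofReal (rexp C) * ∑' n : ℕ, ENNReal.ofReal (rexp (-n)) *
    ENNReal.ofReal ((22 + C) * (n + 1)), ENNReal.mul_ne_top (by simp)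
      (tsum_ofReal_exp_neg_mul_ne_top _), fun f hf hf1 => ?_⟩
  have hT := H f hf hf1
  have hm : AEMeasurable (fun t => t + C - (∫ x in (0 : ℝ)..t, f x) ^ 2)
      (volume.restrict (Ioi 0)) :=
    (by fun_prop : Measurable fun t : ℝ => t + C).aemeasurable.sub
      ((aestronglyMeasurable_primitive hf volume).aemeasurable.pow_const 2)
  have h := lintegral_exp_neg_le_tsum hm (fun t ht => by
    have h1 := hT t ht
    have h2 : 0 ≤ t * ∫ x in Ioi t, f x ^ 2 :=
      mul_nonneg ht.le (integral_nonneg fun x => sq_nonneg _)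
    linarith) (fun n => volume_near_extremal_le (k := n + 1) hC (by simp) hf hT)
  calc _ = ∫⁻ t in Ioi 0, ENNReal.ofReal (rexp C) *
        ENNReal.ofReal (rexp (-(t + C - (∫ x in (0 : ℝ)..t, f x) ^ 2))) := by
        refine lintegral_congr fun t => ?_
        rw [← ENNReal.ofReal_mul (Real.exp_nonneg _), ← Real.exp_add]
        congr 2
        ring
    _ = ENNReal.ofReal (rexp C) * ∫⁻ t in Ioi 0,
        ENNReal.ofReal (rexp (-(t + C - (∫ x in (0 : ℝ)..t, f x) ^ 2))) :=
        lintegral_const_mul' _ _ (by simp)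
    _ ≤ _ := by gcongr

end moser

/-! ### Transfer to the plane -/

section transfer

variable {Ω : Set E2} {u : E2 → ℝ} {A p lam : ℝ}

theorem IsTestFun.apply_eq_zero (hu : IsTestFun Ω u) {x : E2} (hx : x ∉ Ω) : u x = 0 :=
  image_eq_zero_of_notMem_tsupport fun h => hx (hu.2.2 h)

theorem IsTestFun.lintegral_norm_fderiv_sq (hu : IsTestFun Ω u) :
    ∫⁻ x, ENNReal.ofReal (‖fderiv ℝ u x‖ ^ 2) =
      ENNReal.ofReal (∫ x in Ω, ‖fderiv ℝ u x‖ ^ 2) := by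
  have hc : Continuous (fderiv ℝ u) := hu.1.continuous_fderiv (by simp)
  have hsupp : HasCompactSupport (fderiv ℝ u) := HasCompactSupport.fderiv ℝ hu.2.1
  rw [setIntegral_eq_integral_of_forall_compl_eq_zero fun x hx => ?_]
  · refine (ofReal_integral_eq_lintegral_ofReal ?_
      (Eventually.of_forall fun x => by positivity)).symm
    refine Continuous.integrable_of_hasCompactSupport (by fun_prop) ?_
    exact hsupp.comp_left (g := fun y => ‖y‖ ^ 2) (by simp)
  · have : fderiv ℝ u x = 0 :=
      image_eq_zero_of_notMem_tsupport fun h => hx (hu.2.2 (tsupport_fderiv_subset ℝ h))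
    simp [this]

theorem IsTestFun.map_rearr_abs (hu : IsTestFun Ω u) (hA : 0 < A)
    (hΩ : volume Ω = ENNReal.ofReal A) :
    ((expMeas A).restrict (Ioi 0)).map (rearr A fun x => |u x|) =
      (volume.restrict Ω).map fun x => |u x| := by
  obtain ⟨M, hM⟩ := exists_abs_le hu.1.continuous hu.2.1
  exact map_rearr hA hΩ hu.1.continuous.abs.measurable (fun x => abs_nonneg _) hM
    fun x hx => by rw [hu.apply_eq_zero hx, abs_zero]

theorem IsTestFun.measurable_rearr_abs (hu : IsTestFun Ω u) (hA : 0 < A) :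
    Measurable (rearr A fun x => |u x|) := by
  obtain ⟨M, hM⟩ := exists_abs_le hu.1.continuous hu.2.1
  exact (monotone_rearr hA.le hM).measurable

theorem IsTestFun.eLpNorm_rearr_abs (hu : IsTestFun Ω u) (hA : 0 < A)
    (hΩ : volume Ω = ENNReal.ofReal A) (q : ℝ≥0∞) :
    eLpNorm (rearr A fun x => |u x|) q ((expMeas A).restrict (Ioi 0)) =
      eLpNorm u q (volume.restrict Ω) := by
  have h1 := eLpNorm_map_measure (p := q) (g := fun y : ℝ => y)
    (μ := (expMeas A).restrict (Ioi 0)) continuous_id.aestronglyMeasurable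
    (hu.measurable_rearr_abs hA).aemeasurable
  have h2 := eLpNorm_map_measure (p := q) (g := fun y : ℝ => y)
    (μ := volume.restrict Ω) continuous_id.aestronglyMeasurable
    hu.1.continuous.abs.measurable.aemeasurable
  rw [hu.map_rearr_abs hA hΩ] at h1
  exact (h1.symm.trans h2).trans (eLpNorm_norm u)

theorem IsTestFun.lintegral_rearr_abs (hu : IsTestFun Ω u) (hA : 0 < A)
    (hΩ : volume Ω = ENNReal.ofReal A) {φ : ℝ → ℝ≥0∞} (hφ : Measurable φ) :
    ∫⁻ x in Ω, φ |u x| =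
      ∫⁻ t in Ioi 0, ENNReal.ofReal (A * rexp (-t)) * φ (rearr A (fun x => |u x|) t) := by
  have hm := hu.measurable_rearr_abs hA
  rw [← lintegral_map hφ hu.1.continuous.abs.measurable, ← hu.map_rearr_abs hA hΩ,
    lintegral_map hφ hm, expMeas, restrict_withDensity measurableSet_Ioi]
  exact lintegral_withDensity_eq_lintegral_mul _ (by fun_prop) (hφ.comp hm)

theorem IsTestFun.memLp_deriv_rearr_abs (hu : IsTestFun Ω u) (hA : 0 < A) :
    MemLp (deriv (rearr A fun x => |u x|)) 2 (volume.restrict (Ioi 0)) ∧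
      4 * π * ∫ t in Ioi 0, deriv (rearr A fun x => |u x|) t ^ 2 ≤
        ∫ x in Ω, ‖fderiv ℝ u x‖ ^ 2 := by
  set g := deriv (rearr A fun x => |u x|) with hg
  have hgm : Measurable g := measurable_deriv _
  have h := lintegral_deriv_rearr_sq_le hA hu.1 hu.2.1
  rw [hu.lintegral_norm_fderiv_sq] at h
  have h' : ∫⁻ t in Ioi 0, ENNReal.ofReal (4 * π * g t ^ 2) ≤
      ENNReal.ofReal (∫ x in Ω, ‖fderiv ℝ u x‖ ^ 2) := (setLIntegral_le_lintegral _ _).trans h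
  have h_int : Integrable (fun t => 4 * π * g t ^ 2) (volume.restrict (Ioi 0)) := by
    refine ⟨by fun_prop, ?_⟩
    rw [hasFiniteIntegral_iff_ofReal (Eventually.of_forall fun t => by positivity)]
    exact h'.trans_lt ENNReal.ofReal_lt_top
  refine ⟨?_, ?_⟩
  · rw [memLp_two_iff_integrable_sq hgm.aestronglyMeasurable]
    exact (integrable_const_mul_iff (by simp [pi_ne_zero]) _).1 h_int
  · rw [← ofReal_integral_eq_lintegral_ofReal h_int (Eventually.of_forall fun t => by positivity),
      integral_const_mul] at h'
    exact (ENNReal.ofReal_le_ofReal_iff (integral_nonneg fun x => by positivity)).1 h'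

theorem IsTestFun.integral_deriv_rearr_abs (hu : IsTestFun Ω u) (hA : 0 < A)
    (hΩ : volume Ω = ENNReal.ofReal A) {t : ℝ} (ht : 0 ≤ t) :
    ∫ s in (0 : ℝ)..t, deriv (rearr A fun x => |u x|) s = rearr A (fun x => |u x|) t := by
  obtain ⟨K, hK⟩ := exists_lipschitzOnWith_rearr hA hu.1 hu.2.1
  obtain ⟨M, hM⟩ := exists_abs_le hu.1.continuous hu.2.1
  have hsub : uIcc 0 t ⊆ Ici 0 := by
    rw [uIcc_of_le ht]
    exact Icc_subset_Ici_self
  rw [(hK.mono hsub).absolutelyContinuousOnInterval.integral_deriv_eq_sub,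
    rearr_eq_zero hA.le hΩ hM (fun x hx => by rw [hu.apply_eq_zero hx, abs_zero]) le_rfl, sub_zero]

theorem exists_lintegral_exp_le (hA : 0 < A) (hΩ : volume Ω = ENNReal.ofReal A) (hp : 1 ≤ p)
    (hlam0 : 0 ≤ lam) (hlam : lam < lambdaP Ω p) :
    ∃ C : ℝ≥0∞, C ≠ ∞ ∧ ∀ u : E2 → ℝ, IsTestFun Ω u → (∫ x in Ω, ‖fderiv ℝ u x‖ ^ 2) ≤ 1 →
      lam * (eLpNorm u (ENNReal.ofReal p) (volume.restrict Ω)).toReal ^ 2 < 1 →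
      ∫⁻ x in Ω, ENNReal.ofReal (rexp (4 * π * u x ^ 2 /
        (1 - lam * (eLpNorm u (ENNReal.ofReal p) (volume.restrict Ω)).toReal ^ 2))) ≤ C := by
  have hΩ' : (volume Ω).toReal = A := by rw [hΩ, ENNReal.toReal_ofReal hA.le]
  have hπ := pi_pos
  obtain ⟨C, hC, H⟩ := exists_lintegral_exp_sq_sub_le (A := A) (p := p) (κ := lam / (4 * π))
    (κp := lambdaP Ω p / (4 * π)) hA.le hp (by positivity) (by gcongr) fun f hf => by
      rw [div_mul_eq_mul_div, div_le_iff₀ (by positivity), mul_comm (∫ t in Ioi 0, f t ^ 2)]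
      exact lambdaP_mul_sq_le_of_memLp hp hA hΩ' hf
  refine ⟨ENNReal.ofReal A * C, ENNReal.mul_ne_top (by simp) hC, fun u hu hu1 hu2 => ?_⟩
  set W := rearr A fun x => |u x| with hW
  set n := (eLpNorm u (ENNReal.ofReal p) (volume.restrict Ω)).toReal with hn
  have hs : 0 < 1 - lam * n ^ 2 := by linarith
  set s := 1 - lam * n ^ 2 with hsdef
  set c := √(4 * π / s) with hc
  have hc2 : c ^ 2 = 4 * π / s := Real.sq_sqrt (by positivity)
  obtain ⟨hg, hg1⟩ := hu.memLp_deriv_rearr_abs hA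
  have hprim : ∀ t, 0 < t → ∫ x in (0 : ℝ)..t, c * deriv W x = c * W t := fun t ht => by
    rw [intervalIntegral.integral_const_mul, hu.integral_deriv_rearr_abs hA hΩ ht.le]
  have hN : (eLpNorm (fun t => ∫ x in (0 : ℝ)..t, c * deriv W x) (ENNReal.ofReal p)
      ((expMeas A).restrict (Ioi 0))).toReal ^ 2 = 4 * π / s * n ^ 2 := by
    have h1 : (fun t => ∫ x in (0 : ℝ)..t, c * deriv W x) =ᵐ[(expMeas A).restrict (Ioi 0)]
        c • W := (ae_restrict_iff' measurableSet_Ioi).2 (Eventually.of_forall hprim)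
    rw [eLpNorm_congr_ae h1, eLpNorm_const_smul, ENNReal.toReal_mul,
      hu.eLpNorm_rearr_abs hA hΩ, ← hn, mul_pow, ← hc2]
    simp
  have hmain := H (fun x => c * deriv W x) (hg.const_mul c) (by
    rw [hN]
    simp_rw [mul_pow]
    rw [integral_const_mul, hc2]
    calc 4 * π / s * ∫ t in Ioi 0, deriv W t ^ 2 = (4 * π * ∫ t in Ioi 0, deriv W t ^ 2) / s := by
          ring
      _ ≤ 1 / s := by
          gcongr
          exact hg1.trans hu1
      _ = _ := by
          field_simp
          rw [hsdef]
          ring)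
  have hφ : Measurable fun y : ℝ => ENNReal.ofReal (rexp (4 * π * y ^ 2 / s)) := by fun_prop
  have h2 := hu.lintegral_rearr_abs hA hΩ hφ
  simp only [sq_abs] at h2
  rw [h2]
  calc _ = ∫⁻ t in Ioi 0, ENNReal.ofReal A *
        ENNReal.ofReal (rexp ((∫ x in (0 : ℝ)..t, c * deriv W x) ^ 2 - t)) := by
        refine setLIntegral_congr_fun measurableSet_Ioi fun t ht => ?_
        rw [hprim t ht, mul_pow, hc2, ← ENNReal.ofReal_mul (by positivity),
          ← ENNReal.ofReal_mul hA.le, mul_assoc, ← Real.exp_add]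
        congr 3
        ring
    _ = ENNReal.ofReal A * _ := lintegral_const_mul' _ _ (by simp)
    _ ≤ _ := by gcongr

end transfer

end helpers

/-- Inequality of Adimurthi–Druet type for the `L^p` remainder. -/
theorem adimurthi_druet_type_Lp (Ω : Set E2) (hne : Ω.Nonempty) (hO : IsOpen Ω)
    (hb : Bornology.IsBounded Ω) (p lam : ℝ) (hp : 2 < p)
    (hlam0 : 0 < lam) (hlam : lam < lambdaP Ω p) :
    (∃ C : ℝ, ∀ u : E2 → ℝ, IsTestFun Ω u →
      (∫ x in Ω, ‖fderiv ℝ u x‖ ^ 2) ≤ 1 →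
      lam * (∫ x in Ω, |u x| ^ p) ^ (2 / p) < 1 →
      (∫ x in Ω, Real.exp (4 * π * u x ^ 2 /
        (1 - lam * (∫ y in Ω, |u y| ^ p) ^ (2 / p)))) ≤ C) ∧
    (∀ u : E2 → ℝ, IsTestFun Ω u →
      (∫ x in Ω, ‖fderiv ℝ u x‖ ^ 2) ≤ 1 →
      lam * (∫ x in Ω, |u x| ^ p) ^ (2 / p) < 1 →
      (∫ x in Ω, Real.exp (4 * π * (1 + lam * (∫ y in Ω, |u y| ^ p) ^ (2 / p)) * u x ^ 2)) ≤
        ∫ x in Ω, Real.exp (4 * π * u x ^ 2 /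
          (1 - lam * (∫ y in Ω, |u y| ^ p) ^ (2 / p)))) := by
  have hfin : volume Ω ≠ ∞ := hb.measure_lt_top.ne
  have hA : 0 < (volume Ω).toReal := ENNReal.toReal_pos (hO.measure_pos volume hne).ne' hfin
  have hΩ : volume Ω = ENNReal.ofReal (volume Ω).toReal := (ENNReal.ofReal_toReal hfin).symm
  constructor
  · obtain ⟨C, hC, H⟩ := exists_lintegral_exp_le hA hΩ (by linarith) hlam0.le hlam
    refine ⟨C.toReal, fun u hu hu1 hu2 => ?_⟩
    have e := integral_abs_rpow_eq (by linarith : 0 < p)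
      (hu.memLp (ENNReal.ofReal p) (volume.restrict Ω)) 2
    rw [Real.rpow_two] at e
    rw [e] at hu2 ⊢
    have hm : Continuous fun x => rexp (4 * π * u x ^ 2 /
        (1 - lam * (eLpNorm u (ENNReal.ofReal p) (volume.restrict Ω)).toReal ^ 2)) := by
      have := hu.1.continuous
      fun_prop
    rw [integral_eq_lintegral_of_nonneg_ae (Eventually.of_forall fun x => Real.exp_nonneg _)
      hm.aestronglyMeasurable]
    exact ENNReal.toReal_mono hC (H u hu hu1 hu2)
  · intro u hu _ hu2
    set ψ := lam * (∫ x in Ω, |u x| ^ p) ^ (2 / p) with hψ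
    have hψ0 : 0 ≤ ψ :=
      mul_nonneg hlam0.le (Real.rpow_nonneg (integral_nonneg fun x => by positivity) _)
    have hs : 0 < 1 - ψ := by linarith
    obtain ⟨M, hM⟩ := exists_abs_le hu.1.continuous hu.2.1
    have hM2 : ∀ x, u x ^ 2 ≤ M ^ 2 := fun x => sq_le_sq.2 ((hM x).trans (le_abs_self M))
    have hπ := pi_pos
    have : IsFiniteMeasure (volume.restrict Ω) := ⟨by simpa using hfin.lt_top⟩
    have hpt : ∀ x, 4 * π * (1 + ψ) * u x ^ 2 ≤ 4 * π * u x ^ 2 / (1 - ψ) := fun x => by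
      rw [le_div_iff₀ hs]
      have : 0 ≤ 4 * π * u x ^ 2 * ψ ^ 2 := by positivity
      linarith
    have hcont := hu.1.continuous
    have h_int : Integrable (fun x => rexp (4 * π * u x ^ 2 / (1 - ψ))) (volume.restrict Ω) := by
      refine Integrable.of_bound (C := rexp (4 * π * M ^ 2 / (1 - ψ)))
        (Continuous.aestronglyMeasurable (by fun_prop)) (Eventually.of_forall fun x => ?_)
      rw [Real.norm_of_nonneg (Real.exp_nonneg _), Real.exp_le_exp]
      have := hM2 x
      gcongr
    refine integral_mono_of_nonneg (Eventually.of_forall fun x => Real.exp_nonneg _) h_int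
      (Eventually.of_forall fun x => Real.exp_le_exp.2 (hpt x))
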